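/- arXiv:2011.09674 — 11 statements merged into one kernel-verified Lean document; each statement's English description precedes it below -/
import Mathlib

section
/- Assume ‖A‖ ≤ C for some C > 0, let 0 < q < 1 and α > C² q / (1 − q). Then for every b ∈ Y, q ‖b‖ ≤ ‖α (A A* + α I)^{-1} b‖ ≤ ‖b‖. -/
/-- `AA* + αI` is bounded below by `α`. -/
theorem mul_norm_le_norm_comp_adjoint_add_smul
    {X Y : Type*} [NormedAddCommGroup X] [InnerProductSpace ℝ X] [CompleteSpace X]
    [NormedAddCommGroup Y] [InnerProductSpace ℝ Y] [CompleteSpace Y]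
    (A : X →L[ℝ] Y) (α : ℝ) (y : Y) :
    α * ‖y‖ ≤ ‖A (ContinuousLinearMap.adjoint A y) + α • y‖ := by
  rcases eq_or_ne y 0 with rfl | hy
  · simp
  refine le_of_mul_le_mul_right ?_ (norm_pos_iff.mpr hy)
  calc α * ‖y‖ * ‖y‖ ≤ ‖ContinuousLinearMap.adjoint A y‖ ^ 2 + α * ‖y‖ ^ 2 := by
        nlinarith [sq_nonneg ‖ContinuousLinearMap.adjoint A y‖]
    _ = inner ℝ (A (ContinuousLinearMap.adjoint A y) + α • y) y := by
        rw [inner_add_left, real_inner_smul_left, real_inner_self_eq_norm_sq,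
          ← ContinuousLinearMap.adjoint_inner_right, real_inner_self_eq_norm_sq]
    _ ≤ ‖A (ContinuousLinearMap.adjoint A y) + α • y‖ * ‖y‖ := real_inner_le_norm _ _

/-- If `‖A‖ ≤ C`, then `AA* + αI` is bounded above by `C² + α`. -/
theorem norm_comp_adjoint_add_smul_le
    {X Y : Type*} [NormedAddCommGroup X] [InnerProductSpace ℝ X] [CompleteSpace X]
    [NormedAddCommGroup Y] [InnerProductSpace ℝ Y] [CompleteSpace Y]
    (A : X →L[ℝ] Y) {C : ℝ} (hAC : ‖A‖ ≤ C) {α : ℝ} (hα : 0 ≤ α) (y : Y) :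
    ‖A (ContinuousLinearMap.adjoint A y) + α • y‖ ≤ (C ^ 2 + α) * ‖y‖ := by
  have hC : 0 ≤ C := (norm_nonneg A).trans hAC
  have hadj : ‖ContinuousLinearMap.adjoint A‖ ≤ C := by
    rwa [LinearIsometryEquiv.norm_map]
  calc ‖A (ContinuousLinearMap.adjoint A y) + α • y‖
      ≤ ‖A (ContinuousLinearMap.adjoint A y)‖ + ‖α • y‖ := norm_add_le _ _
    _ ≤ C * (C * ‖y‖) + α * ‖y‖ := by
        rw [norm_smul, Real.norm_of_nonneg hα]
        gcongr
        exact (A.le_of_opNorm_le hAC _).trans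
          (mul_le_mul_of_nonneg_left (ContinuousLinearMap.le_of_opNorm_le _ hadj y) hC)
    _ = (C ^ 2 + α) * ‖y‖ := by ring

/-- If `‖A‖ ≤ C`, `0 < q < 1` and `α > C² q / (1 - q)`, then with
`S = (AA* + αI)⁻¹` (given as a two-sided inverse): `q ‖b‖ ≤ ‖α • S b‖ ≤ ‖b‖` for all `b`. -/
theorem stmt_2
    {X Y : Type*} [NormedAddCommGroup X] [InnerProductSpace ℝ X] [CompleteSpace X]
    [NormedAddCommGroup Y] [InnerProductSpace ℝ Y] [CompleteSpace Y]
    (A : X →L[ℝ] Y) (C : ℝ) (hC : 0 < C) (hAC : ‖A‖ ≤ C)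
    (q : ℝ) (hq0 : 0 < q) (hq1 : q < 1)
    (α : ℝ) (hα : C ^ 2 * q / (1 - q) < α)
    (S : Y →L[ℝ] Y)
    (hS1 : (A ∘L ContinuousLinearMap.adjoint A + α • (1 : Y →L[ℝ] Y)) ∘L S = 1)
    (hS2 : S ∘L (A ∘L ContinuousLinearMap.adjoint A + α • (1 : Y →L[ℝ] Y)) = 1)
    (b : Y) :
    q * ‖b‖ ≤ ‖α • S b‖ ∧ ‖α • S b‖ ≤ ‖b‖ := by
  have hα0 : 0 < α := lt_of_le_of_lt (div_nonneg (by positivity) (by linarith)) hα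
  have hqα : q * (C ^ 2 + α) ≤ α := by
    rw [div_lt_iff₀ (by linarith)] at hα
    linarith
  have hb : A (ContinuousLinearMap.adjoint A (S b)) + α • S b = b := by
    simpa using congrArg (fun T : Y →L[ℝ] Y => T b) hS1
  rw [norm_smul, Real.norm_of_nonneg hα0.le]
  constructor
  · calc q * ‖b‖ ≤ q * ((C ^ 2 + α) * ‖S b‖) :=
          mul_le_mul_of_nonneg_left ((congrArg norm hb).symm.trans_le
            (norm_comp_adjoint_add_smul_le A hAC hα0.le (S b))) hq0.le
      _ = q * (C ^ 2 + α) * ‖S b‖ := by ring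
      _ ≤ α * ‖S b‖ := mul_le_mul_of_nonneg_right hqα (norm_nonneg _)
  · exact (mul_norm_le_norm_comp_adjoint_add_smul A α (S b)).trans_eq (congrArg norm hb)
end

section
/- For any two bounded linear operators A, B : X → Y and α > 0, the identity (A*A + αI)^{-1} A* − (B*B + αI)^{-1} B* = (A*A + αI)^{-1} (A − B)* + (A*A + αI)^{-1} ( A*(B − A) + (B − A)* B ) (B*B + αI)^{-1} B* holds. -/
/-- For bounded linear operators `A B : X → Y` and `α > 0`, with
`TA = (A*A + αI)⁻¹` and `TB = (B*B + αI)⁻¹` (given as two-sided inverses), the identity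
`TA ∘ A* - TB ∘ B* = TA ∘ (A - B)* + TA ∘ (A* ∘ (B - A) + (B - A)* ∘ B) ∘ TB ∘ B*` holds. -/
theorem stmt_4
    {X Y : Type*} [NormedAddCommGroup X] [InnerProductSpace ℝ X] [CompleteSpace X]
    [NormedAddCommGroup Y] [InnerProductSpace ℝ Y] [CompleteSpace Y]
    (A B : X →L[ℝ] Y) (α : ℝ) (hα : 0 < α)
    (TA : X →L[ℝ] X)
    (hTA1 : (ContinuousLinearMap.adjoint A ∘L A + α • (1 : X →L[ℝ] X)) ∘L TA = 1)
    (hTA2 : TA ∘L (ContinuousLinearMap.adjoint A ∘L A + α • (1 : X →L[ℝ] X)) = 1)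
    (TB : X →L[ℝ] X)
    (hTB1 : (ContinuousLinearMap.adjoint B ∘L B + α • (1 : X →L[ℝ] X)) ∘L TB = 1)
    (hTB2 : TB ∘L (ContinuousLinearMap.adjoint B ∘L B + α • (1 : X →L[ℝ] X)) = 1) :
    TA ∘L ContinuousLinearMap.adjoint A - TB ∘L ContinuousLinearMap.adjoint B =
      TA ∘L ContinuousLinearMap.adjoint (A - B) +
        ((TA ∘L (ContinuousLinearMap.adjoint A ∘L (B - A) +
          ContinuousLinearMap.adjoint (B - A) ∘L B)) ∘L TB) ∘L
            ContinuousLinearMap.adjoint B := by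
  ext y
  set u := ContinuousLinearMap.adjoint B y with hu
  have h₁ := DFunLike.congr_fun hTA2 (TB u)
  have h₂ := congrArg TA (DFunLike.congr_fun hTB1 u)
  simp only [ContinuousLinearMap.comp_apply, add_apply,
    smul_apply, one_apply_eq_self, map_add] at h₁ h₂
  simp only [ContinuousLinearMap.comp_apply, add_apply,
    sub_apply, map_add, map_sub, ← hu]
  linear_combination (norm := module) h₁ - h₂
end

section
/- Let F : X → Y be a map, x, x* ∈ X, and A : X → Y a bounded linear operator such that ‖F(x*) − F(x) − A(x* − x)‖ ≤ η ‖F(x*) − F(x)‖ for some 0 ≤ η < 1. Let y := F(x*), let y^δ ∈ Y with ‖y^δ − y‖ ≤ δ for some δ ≥ 0, let α > 0, set h := (A*A + αI)^{-1} A* (y^δ − F(x)), x₊ := x + h, and B := A(x₊ − x) + F(x) − y^δ. Then ‖x₊ − x*‖² − ‖x − x*‖² ≤ 2 α^{-1} ‖B‖ ( −‖B‖ + η ‖F(x) − y^δ‖ + (1 + η) δ ) − ‖x₊ − x‖². -/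
/-- one-step estimate for the Levenberg-Marquardt update. With
`h := (A*A + αI)⁻¹ A* (y^δ - F x)` (the inverse given as a two-sided inverse `T`),
`x₊ := x + h` and `B := A (x₊ - x) + F x - y^δ`:
`‖x₊ - x*‖² - ‖x - x*‖² ≤ 2 α⁻¹ ‖B‖ (-‖B‖ + η ‖F x - y^δ‖ + (1 + η) δ) - ‖x₊ - x‖²`. -/
theorem stmt_5
    {X Y : Type*} [NormedAddCommGroup X] [InnerProductSpace ℝ X] [CompleteSpace X]
    [NormedAddCommGroup Y] [InnerProductSpace ℝ Y] [CompleteSpace Y]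
    (F : X → Y) (x xstar : X) (A : X →L[ℝ] Y)
    (η : ℝ) (hη0 : 0 ≤ η) (hη1 : η < 1)
    (htcc : ‖F xstar - F x - A (xstar - x)‖ ≤ η * ‖F xstar - F x‖)
    (y : Y) (hy : y = F xstar)
    (δ : ℝ) (hδ : 0 ≤ δ) (yδ : Y) (hnoise : ‖yδ - y‖ ≤ δ)
    (α : ℝ) (hα : 0 < α)
    (T : X →L[ℝ] X)
    (hT1 : (ContinuousLinearMap.adjoint A ∘L A + α • (1 : X →L[ℝ] X)) ∘L T = 1)
    (hT2 : T ∘L (ContinuousLinearMap.adjoint A ∘L A + α • (1 : X →L[ℝ] X)) = 1)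
    (h : X) (hdef : h = T (ContinuousLinearMap.adjoint A (yδ - F x)))
    (xp : X) (hxp : xp = x + h)
    (B : Y) (hB : B = A (xp - x) + F x - yδ) :
    ‖xp - xstar‖ ^ 2 - ‖x - xstar‖ ^ 2 ≤
      2 * α⁻¹ * ‖B‖ * (-‖B‖ + η * ‖F x - yδ‖ + (1 + η) * δ) - ‖xp - x‖ ^ 2 := by
  subst hy hxp
  have hAh : ContinuousLinearMap.adjoint A (A h) + α • h
      = ContinuousLinearMap.adjoint A (yδ - F x) := by
    rw [hdef]
    exact DFunLike.congr_fun hT1 (ContinuousLinearMap.adjoint A (yδ - F x))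
  have hB' : B = A h + F x - yδ := by simpa using hB
  have hopt : α • h = -ContinuousLinearMap.adjoint A B := by
    have : B = A h - (yδ - F x) := by rw [hB']; abel
    rw [this, map_sub, ← hAh]
    abel
  have hinner : α * inner ℝ h (x + h - xstar) = -inner ℝ B (A (x + h - xstar)) := by
    rw [← real_inner_smul_left, hopt, inner_neg_left, ContinuousLinearMap.adjoint_inner_left]
  have hsplit : A (x + h - xstar)
      = B + ((yδ - F xstar) + (F xstar - F x - A (xstar - x))) := by
    rw [hB']
    simp only [map_sub, map_add]
    abel
  have hres : ‖F xstar - F x‖ ≤ ‖F x - yδ‖ + δ := by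
    have := norm_sub_le_norm_sub_add_norm_sub (F xstar) yδ (F x)
    rw [norm_sub_rev (F xstar) yδ, norm_sub_rev yδ (F x)] at this
    linarith
  have herr : ‖(yδ - F xstar) + (F xstar - F x - A (xstar - x))‖
      ≤ η * ‖F x - yδ‖ + (1 + η) * δ := by
    have := norm_add_le (yδ - F xstar) (F xstar - F x - A (xstar - x))
    have := mul_le_mul_of_nonneg_left hres hη0
    linarith
  have hbound : α * inner ℝ h (x + h - xstar)
      ≤ ‖B‖ * (-‖B‖ + η * ‖F x - yδ‖ + (1 + η) * δ) := by
    rw [hinner, hsplit, inner_add_right, real_inner_self_eq_norm_sq]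
    have := neg_le_of_abs_le
      (abs_real_inner_le_norm B ((yδ - F xstar) + (F xstar - F x - A (xstar - x))))
    have := mul_le_mul_of_nonneg_left herr (norm_nonneg B)
    linarith
  have hexpand : ‖x + h - xstar‖ ^ 2 - ‖x - xstar‖ ^ 2
      = 2 * inner ℝ h (x + h - xstar) - ‖h‖ ^ 2 := by
    have := norm_sub_sq_real (x + h - xstar) h
    rw [show x + h - xstar - h = x - xstar by abel, real_inner_comm] at this
    linarith
  have hdiv : inner ℝ h (x + h - xstar)
      ≤ α⁻¹ * (‖B‖ * (-‖B‖ + η * ‖F x - yδ‖ + (1 + η) * δ)) :=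
    (le_inv_mul_iff₀ hα).2 hbound
  rw [hexpand, add_sub_cancel_left]
  linarith
end

section
/- If for some k ∈ ℕ the iterate x_k^δ lies in the closed ball B_ρ(x₀), then ‖x_{k+1}^δ − x*‖² − ‖x_k^δ − x*‖² ≤ 2 (ω_k/α) ‖B_k^δ‖ [ (η − q) ‖F_{[k]}(x_k^δ) − y_{[k]}^δ‖ + (1 + η) δ_{[k]} ] − ‖x_{k+1}^δ − x_k^δ‖². -/
open Metric Filter

section RegularizedStep

variable {X Y : Type*} [NormedAddCommGroup X] [InnerProductSpace ℝ X] [CompleteSpace X]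
  [NormedAddCommGroup Y] [InnerProductSpace ℝ Y] [CompleteSpace Y]

open scoped InnerProductSpace

/-- The normal equation of a regularized step `h`, written in terms of the linearized residual. -/
lemma smul_eq_neg_adjoint_residual {A : X →L[ℝ] Y} {h : X} {r : Y} {α : ℝ}
    (hh : A.adjoint (A h) + α • h = A.adjoint (-r)) :
    α • h = -A.adjoint (A h + r) := by
  rw [map_add, neg_add, ← map_neg _ r, ← hh]
  abel

/-- The linearized residual after a regularized step is at least a fixed fraction of the residual
before the step. -/
lemma mul_norm_le_norm_residual {A : X →L[ℝ] Y} {h : X} {r : Y} {α C q : ℝ}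
    (hα : 0 < α) (hq : 0 ≤ q) (hA : ‖A‖ ≤ C) (hqα : C ^ 2 * q ≤ α * (1 - q))
    (hh : A.adjoint (A h) + α • h = A.adjoint (-r)) :
    q * ‖r‖ ≤ ‖A h + r‖ := by
  have hC : 0 ≤ C := (norm_nonneg A).trans hA
  have hnorm : α * ‖h‖ ≤ C * ‖A h + r‖ := by
    rw [← norm_smul_of_nonneg hα.le, smul_eq_neg_adjoint_residual hh, norm_neg]
    refine ContinuousLinearMap.le_of_opNorm_le _ ?_ _
    rwa [LinearIsometryEquiv.norm_map]
  have hAh : ‖A h‖ ≤ C * ‖h‖ := A.le_of_opNorm_le hA h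
  have hr : ‖r‖ ≤ ‖A h + r‖ + ‖A h‖ := by
    simpa using norm_sub_le (A h + r) (A h)
  have hmul : α * ‖r‖ ≤ (α + C ^ 2) * ‖A h + r‖ := by
    nlinarith [mul_le_mul_of_nonneg_left hnorm hC]
  refine le_of_mul_le_mul_left ?_ hα
  nlinarith [mul_le_mul_of_nonneg_left hmul hq,
    mul_le_mul_of_nonneg_right hqα (norm_nonneg (A h + r))]

/-- A regularized step decreases the squared distance to a point up to the linearization
error at that point. -/
lemma mul_inner_add_norm_sq_le {A : X →L[ℝ] Y} {h : X} {r : Y} {α : ℝ} (e : X)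
    (hh : A.adjoint (A h) + α • h = A.adjoint (-r)) :
    α * (⟪h, e⟫_ℝ + ‖h‖ ^ 2) ≤ ‖A h + r‖ * (‖r - A e‖ - ‖A h + r‖) := by
  have heq : α * (⟪h, e⟫_ℝ + ‖h‖ ^ 2) = ⟪A h + r, r - A e⟫_ℝ - ‖A h + r‖ ^ 2 := by
    rw [← real_inner_self_eq_norm_sq h, ← inner_add_right, ← real_inner_smul_left,
      smul_eq_neg_adjoint_residual hh, inner_neg_left, ContinuousLinearMap.adjoint_inner_left,
      ← real_inner_self_eq_norm_sq, ← inner_sub_right, ← inner_neg_right]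
    congr 1
    rw [map_add]
    abel
  rw [heq]
  nlinarith [real_inner_le_norm (A h + r) (r - A e)]

end RegularizedStep

/-- one-step estimate for the loping Levenberg–Marquardt–Kaczmarz iteration.
The step `h k` is characterized by the normal equation
`(A_k* A_k + α I) (h k) = A_k* (y_{[k]}^δ - F_{[k]}(x_k^δ))`, where `A_k = F'_{[k]}(x_k^δ)`. -/
theorem stmt_6
    {X Y : Type*} [NormedAddCommGroup X] [InnerProductSpace ℝ X] [CompleteSpace X]
    [NormedAddCommGroup Y] [InnerProductSpace ℝ Y] [CompleteSpace Y]
    (N : ℕ) (hN : 1 ≤ N)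
    (F : ℕ → X → Y) (F' : ℕ → X → (X →L[ℝ] Y))
    (hFcont : ∀ i < N, Continuous (F i)) (hF'cont : ∀ i < N, Continuous (F' i))
    (x₀ xstar : X) (ρ C η : ℝ) (hρ : 0 < ρ) (hC : 0 < C) (hη0 : 0 ≤ η) (hη1 : η < 1)
    (hA1 : ∀ i < N, ∀ x ∈ closedBall x₀ ρ, ‖F' i x‖ ≤ C)
    (hA2 : ∀ i < N, ∀ x ∈ closedBall x₀ ρ, ∀ x' ∈ closedBall x₀ ρ,
        ‖F i x' - F i x - F' i x (x' - x)‖ ≤ η * ‖F i x' - F i x‖)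
    (y : ℕ → Y) (hA3 : xstar ∈ closedBall x₀ (ρ / 2)) (hsol : ∀ i < N, F i xstar = y i)
    (δ : ℕ → ℝ) (hδ : ∀ i < N, 0 ≤ δ i)
    (yδ : ℕ → Y) (hnoise : ∀ i < N, ‖yδ i - y i‖ ≤ δ i)
    (q α τ : ℝ) (hq0 : 0 < q) (hq1 : q < 1)
    (hα : C ^ 2 * q / (1 - q) < α)
    (hτ : (1 + η) / (1 - η) < τ) (hqτ : η + (1 + η) / τ < q)
    (x h : ℕ → X) (ω : ℕ → ℝ)
    (hx0 : x 0 = x₀)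
    (hω : ∀ k, ω k = if τ * δ (k % N) ≤ ‖F (k % N) (x k) - yδ (k % N)‖ then 1 else 0)
    (hh : ∀ k, ContinuousLinearMap.adjoint (F' (k % N) (x k)) (F' (k % N) (x k) (h k))
        + α • h k
        = ContinuousLinearMap.adjoint (F' (k % N) (x k)) (yδ (k % N) - F (k % N) (x k)))
    (hrec : ∀ k, x (k + 1) = x k + ω k • h k)
    (k : ℕ) (hk : x k ∈ closedBall x₀ ρ) :
    ‖x (k + 1) - xstar‖ ^ 2 - ‖x k - xstar‖ ^ 2 ≤
      2 * (ω k / α) *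
          ‖F' (k % N) (x k) (x (k + 1) - x k) + F (k % N) (x k) - yδ (k % N)‖ *
          ((η - q) * ‖F (k % N) (x k) - yδ (k % N)‖ + (1 + η) * δ (k % N)) -
        ‖x (k + 1) - x k‖ ^ 2 := by
  obtain hω0 | hω1 : ω k = 0 ∨ ω k = 1 := by
    rw [hω k]
    split_ifs <;> simp
  · simp [hrec k, hω0]
  have hi : k % N < N := Nat.mod_lt _ hN
  have hstep := hh k
  have hxs : xstar ∈ closedBall x₀ ρ := closedBall_subset_closedBall (by linarith) hA3
  have hcone := hA2 _ hi _ hk _ hxs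
  have hdata := hnoise _ hi
  have hA := hA1 _ hi _ hk
  rw [hsol _ hi] at hcone
  rw [hrec k, hω1, one_smul, add_sub_cancel_left]
  generalize F' (k % N) (x k) = A at *
  generalize F (k % N) (x k) = f at *
  generalize yδ (k % N) = z at *
  generalize y (k % N) = w at *
  generalize δ (k % N) = d at *
  generalize h k = s at *
  rw [← neg_sub f z] at hstep
  have hq1' : 0 < 1 - q := by linarith
  have hα0 : 0 < α := lt_of_le_of_lt (by positivity) hα
  have hqα : C ^ 2 * q ≤ α * (1 - q) := ((div_lt_iff₀ hq1').1 hα).le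
  have hres := mul_norm_le_norm_residual hα0 hq0.le hA hqα hstep
  have hdec := mul_inner_add_norm_sq_le (x k - xstar) hstep
  have hwf : ‖w - f‖ ≤ ‖f - z‖ + d := by
    calc ‖w - f‖ = ‖(f - z) + (z - w)‖ := by rw [sub_add_sub_cancel, norm_sub_rev]
      _ ≤ ‖f - z‖ + d := (norm_add_le _ _).trans (by gcongr)
  have hlin : ‖f - z - A (x k - xstar)‖ ≤ η * ‖f - z‖ + (1 + η) * d := by
    calc ‖f - z - A (x k - xstar)‖ = ‖(w - f - A (xstar - x k)) + (z - w)‖ := by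
          rw [← norm_neg, ← neg_sub xstar (x k), map_neg]
          congr 1
          abel
      _ ≤ η * ‖w - f‖ + d := (norm_add_le _ _).trans (add_le_add hcone hdata)
      _ ≤ η * ‖f - z‖ + (1 + η) * d := by nlinarith [mul_le_mul_of_nonneg_left hwf hη0]
  have hbound : inner ℝ s (x k - xstar) + ‖s‖ ^ 2 ≤
      1 / α * (‖A s + (f - z)‖ * ((η - q) * ‖f - z‖ + (1 + η) * d)) := by
    rw [one_div, ← div_eq_inv_mul, le_div_iff₀' hα0]
    refine hdec.trans ?_
    gcongr
    linarith
  rw [add_sub_right_comm, add_comm (x k - xstar), norm_add_sq_real, add_sub_assoc (A s)]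
  linarith
end

section
/- For every k ∈ ℕ the l-LMK iterate x_k^δ lies in the closed ball B_{ρ/2}(x*) (which is contained in B_ρ(x₀)), and the monotonicity property ‖x_{k+1}^δ − x*‖ ≤ ‖x_k^δ − x*‖ holds. -/
open Metric Filter

/-- A regularised Gauss-Newton step `h` has linearised residual at least `q` times the residual
when the regularisation parameter is large enough. -/
theorem mul_norm_le_norm_linearized_residual
    {X Y : Type*} [NormedAddCommGroup X] [InnerProductSpace ℝ X] [CompleteSpace X]
    [NormedAddCommGroup Y] [InnerProductSpace ℝ Y] [CompleteSpace Y]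
    {A : X →L[ℝ] Y} {h : X} {r : Y} {C q α : ℝ} (hA : ‖A‖ ≤ C) (hα0 : 0 < α) (hq0 : 0 ≤ q)
    (hα : q * (C ^ 2 + α) ≤ α)
    (hh : ContinuousLinearMap.adjoint A (A h) + α • h = ContinuousLinearMap.adjoint A r) :
    q * ‖r‖ ≤ ‖A h - r‖ := by
  have hstep : α • h = -ContinuousLinearMap.adjoint A (A h - r) := by
    rw [map_sub, ← hh]; abel
  have hr : α • r = -(A (ContinuousLinearMap.adjoint A (A h - r)) + α • (A h - r)) := by
    have := congrArg A hstep
    rw [map_smul, map_neg] at this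
    rw [smul_sub, this]; abel
  have hAA : ‖A (ContinuousLinearMap.adjoint A (A h - r))‖ ≤ C ^ 2 * ‖A h - r‖ := by
    have h1 := A.le_of_opNorm_le hA (ContinuousLinearMap.adjoint A (A h - r))
    have h2 := (ContinuousLinearMap.adjoint A).le_of_opNorm_le
      ((ContinuousLinearMap.adjoint.norm_map A).trans_le hA) (A h - r)
    have hC : 0 ≤ C := (norm_nonneg A).trans hA
    nlinarith [mul_le_mul_of_nonneg_left h2 hC]
  have hle : α * ‖r‖ ≤ (C ^ 2 + α) * ‖A h - r‖ := by
    have h1 := norm_add_le (A (ContinuousLinearMap.adjoint A (A h - r))) (α • (A h - r))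
    rw [← norm_neg, ← hr, norm_smul, norm_smul, Real.norm_of_nonneg hα0.le] at h1
    linarith
  refine le_of_mul_le_mul_left ?_ hα0
  nlinarith [mul_le_mul_of_nonneg_left hle hq0,
    mul_le_mul_of_nonneg_right hα (norm_nonneg (A h - r))]

/-- A regularised Gauss-Newton step does not increase the error `e` when the residual is predicted
by the linearisation up to a relative error `q` not exceeding the linearised residual. -/
theorem norm_add_regularized_step_le
    {X Y : Type*} [NormedAddCommGroup X] [InnerProductSpace ℝ X] [CompleteSpace X]
    [NormedAddCommGroup Y] [InnerProductSpace ℝ Y] [CompleteSpace Y]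
    {A : X →L[ℝ] Y} {e h : X} {r : Y} {α : ℝ} (hα0 : 0 < α)
    (hh : ContinuousLinearMap.adjoint A (A h) + α • h = ContinuousLinearMap.adjoint A r)
    (hw : ‖r + A e‖ ≤ ‖A h - r‖) :
    ‖e + h‖ ≤ ‖e‖ := by
  have hinner : ∀ u : X, α * inner ℝ u h = inner ℝ (A u) r - inner ℝ (A u) (A h) := by
    intro u
    have := congrArg (inner ℝ u) hh
    rw [inner_add_right, inner_smul_right, ContinuousLinearMap.adjoint_inner_right,
      ContinuousLinearMap.adjoint_inner_right] at this
    linarith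
  have he := hinner e
  have hself := hinner h
  rw [real_inner_self_eq_norm_sq] at hself
  have hcs := neg_le_of_abs_le (abs_real_inner_le_norm (r + A e) (A h - r))
  have hprod := mul_le_mul_of_nonneg_right hw (norm_nonneg (A h - r))
  have hres := real_inner_self_eq_norm_sq (A h - r)
  simp only [inner_add_left, inner_sub_left, inner_sub_right] at hcs hres
  have hsymm := real_inner_comm r (A h)
  have hsq := norm_add_sq_real e h
  refine (sq_le_sq₀ (norm_nonneg _) (norm_nonneg _)).1 ?_
  refine le_of_mul_le_mul_left ?_ hα0
  nlinarith [mul_nonneg hα0.le (sq_nonneg ‖h‖)]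

/-- monotonicity of the l-LMK iteration: every iterate stays in the closed
ball `B_{ρ/2}(x*)` (which is contained in `B_ρ(x₀)`), and the errors are non-increasing. -/
theorem stmt_7
    {X Y : Type*} [NormedAddCommGroup X] [InnerProductSpace ℝ X] [CompleteSpace X]
    [NormedAddCommGroup Y] [InnerProductSpace ℝ Y] [CompleteSpace Y]
    (N : ℕ) (hN : 1 ≤ N)
    (F : ℕ → X → Y) (F' : ℕ → X → (X →L[ℝ] Y))
    (hFcont : ∀ i < N, Continuous (F i)) (hF'cont : ∀ i < N, Continuous (F' i))
    (x₀ xstar : X) (ρ C η : ℝ) (hρ : 0 < ρ) (hC : 0 < C) (hη0 : 0 ≤ η) (hη1 : η < 1)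
    (hA1 : ∀ i < N, ∀ x ∈ closedBall x₀ ρ, ‖F' i x‖ ≤ C)
    (hA2 : ∀ i < N, ∀ x ∈ closedBall x₀ ρ, ∀ x' ∈ closedBall x₀ ρ,
        ‖F i x' - F i x - F' i x (x' - x)‖ ≤ η * ‖F i x' - F i x‖)
    (y : ℕ → Y) (hA3 : xstar ∈ closedBall x₀ (ρ / 2)) (hsol : ∀ i < N, F i xstar = y i)
    (δ : ℕ → ℝ) (hδ : ∀ i < N, 0 ≤ δ i)
    (yδ : ℕ → Y) (hnoise : ∀ i < N, ‖yδ i - y i‖ ≤ δ i)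
    (q α τ : ℝ) (hq0 : 0 < q) (hq1 : q < 1)
    (hα : C ^ 2 * q / (1 - q) < α)
    (hτ : (1 + η) / (1 - η) < τ) (hqτ : η + (1 + η) / τ < q)
    (x h : ℕ → X) (ω : ℕ → ℝ)
    (hx0 : x 0 = x₀)
    (hω : ∀ k, ω k = if τ * δ (k % N) ≤ ‖F (k % N) (x k) - yδ (k % N)‖ then 1 else 0)
    (hh : ∀ k, ContinuousLinearMap.adjoint (F' (k % N) (x k)) (F' (k % N) (x k) (h k))
        + α • h k
        = ContinuousLinearMap.adjoint (F' (k % N) (x k)) (yδ (k % N) - F (k % N) (x k)))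
    (hrec : ∀ k, x (k + 1) = x k + ω k • h k)
    :
    closedBall xstar (ρ / 2) ⊆ closedBall x₀ ρ ∧
      ∀ k : ℕ, x k ∈ closedBall xstar (ρ / 2) ∧ ‖x (k + 1) - xstar‖ ≤ ‖x k - xstar‖ := by
  have hsub : closedBall xstar (ρ / 2) ⊆ closedBall x₀ ρ := by
    refine closedBall_subset_closedBall' ?_
    have := mem_closedBall.1 hA3
    linarith
  have hα0 : 0 < α :=
    (div_nonneg (by positivity) (by linarith : (0 : ℝ) ≤ 1 - q)).trans_lt hα
  have hqα : q * (C ^ 2 + α) ≤ α := by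
    rw [div_lt_iff₀ (by linarith)] at hα
    linarith
  have hτ0 : 0 < τ := (div_nonneg (by linarith) (by linarith)).trans_lt hτ
  have hxstar : xstar ∈ closedBall x₀ ρ := hsub (mem_closedBall_self (by positivity))
  have hmono : ∀ k, x k ∈ closedBall xstar (ρ / 2) → ‖x (k + 1) - xstar‖ ≤ ‖x k - xstar‖ := by
    intro k hk
    have hi : k % N < N := Nat.mod_lt _ hN
    rw [hrec, hω]
    split_ifs with hdisc
    · have hw : ‖yδ (k % N) - F (k % N) (x k) + F' (k % N) (x k) (x k - xstar)‖
          ≤ q * ‖yδ (k % N) - F (k % N) (x k)‖ := by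
        have hlin := hA2 _ hi (x k) (hsub hk) xstar hxstar
        rw [hsol _ hi] at hlin
        have hn := hnoise _ hi
        have htri := norm_add_le (yδ (k % N) - y (k % N))
          (y (k % N) - F (k % N) (x k) - F' (k % N) (x k) (xstar - x k))
        have hres := norm_sub_le (yδ (k % N) - F (k % N) (x k)) (yδ (k % N) - y (k % N))
        rw [sub_sub_sub_cancel_left] at hres
        have hexp : yδ (k % N) - F (k % N) (x k) + F' (k % N) (x k) (x k - xstar)
            = yδ (k % N) - y (k % N)
              + (y (k % N) - F (k % N) (x k) - F' (k % N) (x k) (xstar - x k)) := by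
          rw [map_sub, map_sub]; abel
        rw [hexp]
        rw [norm_sub_rev] at hdisc
        have hδr : (1 + η) * δ (k % N)
            ≤ (1 + η) / τ * ‖yδ (k % N) - F (k % N) (x k)‖ := by
          rw [div_mul_eq_mul_div, le_div_iff₀ hτ0]
          nlinarith
        nlinarith [mul_le_mul_of_nonneg_left hres hη0, mul_le_mul_of_nonneg_left hn hη0,
          mul_le_mul_of_nonneg_right hqτ.le (norm_nonneg (yδ (k % N) - F (k % N) (x k)))]
      rw [one_smul, add_sub_right_comm]
      exact norm_add_regularized_step_le hα0 (hh k) (hw.trans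
        (mul_norm_le_norm_linearized_residual (hA1 _ hi _ (hsub hk)) hα0 hq0.le hqα (hh k)))
    · simp
  have hmem : ∀ k, x k ∈ closedBall xstar (ρ / 2) := by
    intro k
    induction k with
    | zero => rwa [hx0, mem_closedBall_comm]
    | succ k ih =>
      have := hmono k ih
      rw [mem_closedBall_iff_norm] at ih ⊢
      exact this.trans ih
  exact ⟨hsub, fun k => ⟨hmem k, hmono k (hmem k)⟩⟩
end

section
/- In the exact-data case, the quantities B_k of the LMK iteration are square summable with the quantitative bound Σ_{k=0}^∞ ‖B_k‖² ≤ α (2 (q − η))^{-1} ‖x₀ − x*‖² < ∞. -/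
open Metric Filter

/-- A convergence criterion by telescoping: if `c * b k + a (k + 1) ≤ a k` with `a`, `b` nonnegative,
then `b` is summable with sum at most `c⁻¹ * a 0`. -/
theorem summable_and_tsum_le_of_mul_add_succ_le {a b : ℕ → ℝ} {c : ℝ} (hc : 0 < c)
    (ha : ∀ k, 0 ≤ a k) (hb : ∀ k, 0 ≤ b k) (hab : ∀ k, c * b k + a (k + 1) ≤ a k) :
    Summable b ∧ ∑' k, b k ≤ c⁻¹ * a 0 := by
  have partial_le (n : ℕ) : ∑ k ∈ Finset.range n, b k ≤ c⁻¹ * a 0 := by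
    have telescope : c * ∑ k ∈ Finset.range n, b k + a n ≤ a 0 := by
      induction n with
      | zero => simp
      | succ n ih =>
        rw [Finset.sum_range_succ, mul_add]
        linarith [hab n]
    rw [inv_mul_eq_div, le_div_iff₀' hc]
    linarith [ha n]
  exact ⟨summable_of_sum_range_le hb partial_le, Real.tsum_le_of_sum_range_le hb partial_le⟩

section LevenbergMarquardtStep

variable {X Y : Type*} [NormedAddCommGroup X] [InnerProductSpace ℝ X] [CompleteSpace X]
  [NormedAddCommGroup Y] [InnerProductSpace ℝ Y] [CompleteSpace Y]

/-- The residual of a regularized step is controlled by the linearized residual. -/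
theorem mul_norm_residual_le {A : X →L[ℝ] Y} {h : X} {r : Y} {C α q : ℝ}
    (hα : 0 < α) (hq : 0 ≤ q) (hA : ‖A‖ ≤ C) (hC : C ^ 2 * q ≤ α * (1 - q))
    (hstep : A.adjoint (A h + r) + α • h = 0) :
    q * ‖r‖ ≤ ‖A h + r‖ := by
  have hC0 : 0 ≤ C := (norm_nonneg A).trans hA
  have norm_h : α * ‖h‖ ≤ C * ‖A h + r‖ := by
    calc α * ‖h‖ = ‖α • h‖ := by rw [norm_smul, Real.norm_of_nonneg hα.le]
      _ = ‖A.adjoint (A h + r)‖ := by rw [eq_neg_of_add_eq_zero_left hstep, norm_neg]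
      _ ≤ C * ‖A h + r‖ := A.adjoint.le_of_opNorm_le
          (by rwa [LinearIsometryEquiv.norm_map]) _
  have norm_Ah : α * ‖A h‖ ≤ C ^ 2 * ‖A h + r‖ := by
    calc α * ‖A h‖ ≤ α * (C * ‖h‖) := by gcongr; exact A.le_of_opNorm_le hA h
      _ = C * (α * ‖h‖) := by ring
      _ ≤ C * (C * ‖A h + r‖) := by gcongr
      _ = C ^ 2 * ‖A h + r‖ := by ring
  have norm_r : ‖r‖ ≤ ‖A h + r‖ + ‖A h‖ := by
    simpa using norm_sub_le (A h + r) (A h)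
  refine le_of_mul_le_mul_left ?_ hα
  calc α * (q * ‖r‖) ≤ q * (α * (‖A h + r‖ + ‖A h‖)) := by
        rw [mul_left_comm]; gcongr
    _ = q * α * ‖A h + r‖ + q * (α * ‖A h‖) := by ring
    _ ≤ q * α * ‖A h + r‖ + q * (C ^ 2 * ‖A h + r‖) := by gcongr
    _ = q * α * ‖A h + r‖ + C ^ 2 * q * ‖A h + r‖ := by ring
    _ ≤ q * α * ‖A h + r‖ + α * (1 - q) * ‖A h + r‖ := by gcongr
    _ = α * ‖A h + r‖ := by ring

/-- The squared error decreases along a regularized step by a multiple of the squared linearized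
residual, provided the linearization error satisfies a tangential cone bound. -/
theorem mul_sq_norm_add_sq_norm_le {A : X →L[ℝ] Y} {e h : X} {r : Y} {C α q η : ℝ}
    (hα : 0 < α) (hη : 0 ≤ η) (hηq : η < q) (hq : q ≤ 1) (hA : ‖A‖ ≤ C)
    (hC : C ^ 2 * q ≤ α * (1 - q)) (hcone : ‖A e - r‖ ≤ η * ‖r‖)
    (hstep : A.adjoint (A h + r) + α • h = 0) :
    2 * (q - η) / α * ‖A h + r‖ ^ 2 + ‖e + h‖ ^ 2 ≤ ‖e‖ ^ 2 := by
  have hq0 : 0 < q := hη.trans_lt hηq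
  have hr := mul_norm_residual_le hα hq0.le hA hC hstep
  set B := A h + r with hB
  have inner_step (v : X) : inner ℝ (A v) B = -(α * inner ℝ v h) := by
    rw [← ContinuousLinearMap.adjoint_inner_right, eq_neg_of_add_eq_zero_left hstep,
      inner_neg_right, real_inner_smul_right]
  have inner_r : inner ℝ r B = ‖B‖ ^ 2 + α * ‖h‖ ^ 2 := by
    rw [show r = B - A h by rw [hB]; abel, inner_sub_left, inner_step,
      real_inner_self_eq_norm_sq, real_inner_self_eq_norm_sq]
    ring
  have inner_error : -(η * ‖r‖ * ‖B‖) ≤ inner ℝ (A e - r) B :=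
    (abs_le.1 ((abs_real_inner_le_norm _ _).trans (by gcongr))).1
  rw [inner_sub_left, inner_step, inner_r] at inner_error
  have cone_term : η * ‖r‖ * ‖B‖ ≤ (1 - q + η) * ‖B‖ ^ 2 := by
    have hηr : η * ‖r‖ ≤ (1 - q + η) * ‖B‖ := by
      refine le_of_mul_le_mul_left ?_ hq0
      have : η ≤ q * (1 - q + η) := by nlinarith
      calc q * (η * ‖r‖) = η * (q * ‖r‖) := by ring
        _ ≤ η * ‖B‖ := by gcongr
        _ ≤ q * (1 - q + η) * ‖B‖ := by gcongr
        _ = q * ((1 - q + η) * ‖B‖) := by ring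
    calc η * ‖r‖ * ‖B‖ ≤ (1 - q + η) * ‖B‖ * ‖B‖ := by gcongr
      _ = (1 - q + η) * ‖B‖ ^ 2 := by ring
  rw [norm_add_sq_real e h]
  refine le_of_mul_le_mul_left ?_ hα
  have cancel : α * (2 * (q - η) / α * ‖B‖ ^ 2) = 2 * (q - η) * ‖B‖ ^ 2 := by
    field_simp
  have : 0 ≤ α * ‖h‖ ^ 2 := by positivity
  rw [mul_add, cancel]
  linarith

end LevenbergMarquardtStep

/-- exact data: the quantities `B_k = F'_{[k]}(x_k)(x_{k+1} - x_k) +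
F_{[k]}(x_k) - y_{[k]}` are square summable with
`∑ₖ ‖B_k‖² ≤ α (2 (q - η))⁻¹ ‖x₀ - x*‖² < ∞`. -/
theorem stmt_9
    {X Y : Type*} [NormedAddCommGroup X] [InnerProductSpace ℝ X] [CompleteSpace X]
    [NormedAddCommGroup Y] [InnerProductSpace ℝ Y] [CompleteSpace Y]
    (N : ℕ) (hN : 1 ≤ N)
    (F : ℕ → X → Y) (F' : ℕ → X → (X →L[ℝ] Y))
    (hFcont : ∀ i < N, Continuous (F i)) (hF'cont : ∀ i < N, Continuous (F' i))
    (x₀ xstar : X) (ρ C η : ℝ) (hρ : 0 < ρ) (hC : 0 < C) (hη0 : 0 ≤ η) (hη1 : η < 1)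
    (hA1 : ∀ i < N, ∀ x ∈ closedBall x₀ ρ, ‖F' i x‖ ≤ C)
    (hA2 : ∀ i < N, ∀ x ∈ closedBall x₀ ρ, ∀ x' ∈ closedBall x₀ ρ,
        ‖F i x' - F i x - F' i x (x' - x)‖ ≤ η * ‖F i x' - F i x‖)
    (y : ℕ → Y) (hA3 : xstar ∈ closedBall x₀ (ρ / 2)) (hsol : ∀ i < N, F i xstar = y i)
    (q α τ : ℝ) (hq0 : 0 < q) (hq1 : q < 1)
    (hα : C ^ 2 * q / (1 - q) < α)
    (hτ : (1 + η) / (1 - η) < τ) (hqτ : η + (1 + η) / τ < q)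
    (x h : ℕ → X)
    (hx0 : x 0 = x₀)
    (hh : ∀ k, ContinuousLinearMap.adjoint (F' (k % N) (x k)) (F' (k % N) (x k) (h k))
        + α • h k
        = ContinuousLinearMap.adjoint (F' (k % N) (x k)) (y (k % N) - F (k % N) (x k)))
    (hrec : ∀ k, x (k + 1) = x k + h k)
    :
    Summable (fun k : ℕ =>
        ‖F' (k % N) (x k) (x (k + 1) - x k) + F (k % N) (x k) - y (k % N)‖ ^ 2) ∧
      ∑' k : ℕ, ‖F' (k % N) (x k) (x (k + 1) - x k) + F (k % N) (x k) - y (k % N)‖ ^ 2 ≤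
        α * (2 * (q - η))⁻¹ * ‖x₀ - xstar‖ ^ 2 := by
  have hτ0 : 0 < τ := lt_trans (div_pos (by linarith) (by linarith)) hτ
  have hηq : η < q := by
    have : 0 < (1 + η) / τ := by positivity
    linarith
  have hα0 : 0 < α :=
    lt_of_le_of_lt (div_nonneg (by positivity) (by linarith)) hα
  have hCq : C ^ 2 * q ≤ α * (1 - q) := ((div_lt_iff₀ (by linarith)).1 hα).le
  have hc : 0 < 2 * (q - η) / α := div_pos (by linarith) hα0
  have hstar : dist xstar x₀ ≤ ρ / 2 := hA3
  have decrease (k : ℕ) (hk : ‖x k - xstar‖ ≤ ρ / 2) :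
      2 * (q - η) / α *
          ‖F' (k % N) (x k) (x (k + 1) - x k) + F (k % N) (x k) - y (k % N)‖ ^ 2 +
        ‖x (k + 1) - xstar‖ ^ 2 ≤ ‖x k - xstar‖ ^ 2 := by
    have hi : k % N < N := Nat.mod_lt _ hN
    have hxk : x k ∈ closedBall x₀ ρ := by
      rw [mem_closedBall]
      rw [← dist_eq_norm] at hk
      linarith [dist_triangle (x k) xstar x₀]
    have hxstar : xstar ∈ closedBall x₀ ρ := closedBall_subset_closedBall (by linarith) hA3
    have hcone := hA2 _ hi _ hxk _ hxstar
    rw [hsol _ hi, norm_sub_rev (y _) (F _ _)] at hcone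
    have hstep : (F' (k % N) (x k)).adjoint
        (F' (k % N) (x k) (h k) + (F (k % N) (x k) - y (k % N))) + α • h k = 0 := by
      rw [map_add, add_right_comm, hh k, ← map_add]
      simp
    have key := mul_sq_norm_add_sq_norm_le (e := x k - xstar) hα0 hη0 hηq hq1.le
      (hA1 _ hi _ hxk) hCq (by convert hcone using 2; simp only [map_sub]; abel) hstep
    rw [hrec k, add_sub_cancel_left, add_sub_assoc, add_sub_right_comm]
    exact key
  have bound (k : ℕ) : ‖x k - xstar‖ ≤ ρ / 2 := by
    induction k with
    | zero => rwa [hx0, ← dist_eq_norm, dist_comm]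
    | succ k ih =>
      refine le_trans ?_ ih
      refine (sq_le_sq₀ (norm_nonneg _) (norm_nonneg _)).1 ?_
      have := mul_nonneg hc.le (sq_nonneg
        ‖F' (k % N) (x k) (x (k + 1) - x k) + F (k % N) (x k) - y (k % N)‖)
      linarith [decrease k ih]
  have key := summable_and_tsum_le_of_mul_add_succ_le (a := fun k => ‖x k - xstar‖ ^ 2) hc
    (fun k => sq_nonneg _) (fun k => sq_nonneg _) (fun k => decrease k (bound k))
  rwa [inv_div, div_eq_mul_inv, hx0] at key
end

section
/- In the exact-data case, the LMK iteration satisfies Σ_{k=0}^∞ ‖B_k‖ · ‖F_{[k]}(x_k) − y_{[k]}‖ ≤ α (2 (q − η))^{-1} ‖x₀ − x*‖² < ∞. -/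
open Metric Filter

/-- A regularized Gauss-Newton step `h` with small linearization error shrinks the squared error
by a multiple of the product of the linearized residual and the residual. -/
theorem norm_add_sq_le_of_regularized_step
    {X Y : Type*} [NormedAddCommGroup X] [InnerProductSpace ℝ X] [CompleteSpace X]
    [NormedAddCommGroup Y] [InnerProductSpace ℝ Y] [CompleteSpace Y]
    (A : X →L[ℝ] Y) {C η q α : ℝ} (hC : 0 ≤ C) (hq0 : 0 < q) (hq1 : q < 1)
    (hα : C ^ 2 * q / (1 - q) < α) (hA : ‖A‖ ≤ C) {e h : X} {r : Y}
    (hw : ‖A e - r‖ ≤ η * ‖r‖)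
    (hh : ContinuousLinearMap.adjoint A (A h) + α • h = ContinuousLinearMap.adjoint A (-r)) :
    2 * (q - η) * (‖A h + r‖ * ‖r‖) ≤ α * (‖e‖ ^ 2 - ‖e + h‖ ^ 2) := by
  have hα0 : 0 < α := lt_of_le_of_lt (by have := sub_pos.2 hq1; positivity) hα
  set B := A h + r with hB
  set g := ContinuousLinearMap.adjoint A B with hg
  have hαh : α • h = -g := by
    rw [hg, hB, map_add, neg_add, ← map_neg _ r, ← hh]
    abel
  have inner_h (v : X) : α * inner ℝ h v = -inner ℝ B (A v) := by
    rw [← real_inner_smul_left, hαh, inner_neg_left, hg, ContinuousLinearMap.adjoint_inner_left]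
  have hAh : A h = B - r := by rw [hB]; abel
  have h_sq : α * ‖h‖ ^ 2 = -(‖B‖ ^ 2 - inner ℝ B r) := by
    rw [← real_inner_self_eq_norm_sq, inner_h, hAh, inner_sub_right, real_inner_self_eq_norm_sq]
  have h_e : α * inner ℝ h e = -(inner ℝ B r + inner ℝ B (A e - r)) := by
    rw [inner_h, ← inner_add_right, add_sub_cancel]
  have h_cs : -(‖B‖ * (η * ‖r‖)) ≤ inner ℝ B (A e - r) :=
    (neg_le_neg (mul_le_mul_of_nonneg_left hw (norm_nonneg B))).trans
      (neg_le_of_abs_le (abs_real_inner_le_norm B (A e - r)))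
  have h_Br : ‖B‖ ^ 2 ≤ inner ℝ B r := by nlinarith [sq_nonneg ‖h‖]
  have h_res : q * ‖r‖ ≤ ‖B‖ := by
    have h_norm : α * ‖h‖ ≤ C * ‖B‖ := by
      calc α * ‖h‖ = ‖g‖ := by
            rw [← norm_neg g, ← hαh, norm_smul, Real.norm_of_nonneg hα0.le]
        _ ≤ ‖ContinuousLinearMap.adjoint A‖ * ‖B‖ := ContinuousLinearMap.le_opNorm _ _
        _ ≤ C * ‖B‖ := by
            rw [LinearIsometryEquiv.norm_map]
            gcongr
    have h_r : ‖r‖ ≤ ‖B‖ + C * ‖h‖ := by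
      calc ‖r‖ = ‖B - A h‖ := by rw [hAh, sub_sub_cancel]
        _ ≤ ‖B‖ + ‖A h‖ := norm_sub_le _ _
        _ ≤ ‖B‖ + C * ‖h‖ := by gcongr; exact A.le_of_opNorm_le hA h
    have h_param : C ^ 2 * q ≤ α * (1 - q) := ((div_lt_iff₀ (sub_pos.2 hq1)).1 hα).le
    have : α * (q * ‖r‖) ≤ α * ‖B‖ := by
      calc α * (q * ‖r‖) ≤ α * (q * (‖B‖ + C * ‖h‖)) := by gcongr
        _ = α * q * ‖B‖ + q * C * (α * ‖h‖) := by ring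
        _ ≤ α * q * ‖B‖ + q * C * (C * ‖B‖) := by gcongr
        _ = α * q * ‖B‖ + C ^ 2 * q * ‖B‖ := by ring
        _ ≤ α * q * ‖B‖ + α * (1 - q) * ‖B‖ := by gcongr
        _ = α * ‖B‖ := by ring
    exact le_of_mul_le_mul_left this hα0
  have h_exp : α * (‖e‖ ^ 2 - ‖e + h‖ ^ 2) = -(2 * (α * inner ℝ h e) + α * ‖h‖ ^ 2) := by
    rw [norm_add_sq_real, real_inner_comm]
    ring
  rw [h_exp, h_e, h_sq]
  nlinarith [mul_le_mul_of_nonneg_left h_res (norm_nonneg B)]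

/-- exact data: with `B_k = F'_{[k]}(x_k)(x_{k+1} - x_k) + F_{[k]}(x_k) - y_{[k]}`,
`∑ₖ ‖B_k‖ · ‖F_{[k]}(x_k) - y_{[k]}‖ ≤ α (2 (q - η))⁻¹ ‖x₀ - x*‖² < ∞`. -/
theorem stmt_10
    {X Y : Type*} [NormedAddCommGroup X] [InnerProductSpace ℝ X] [CompleteSpace X]
    [NormedAddCommGroup Y] [InnerProductSpace ℝ Y] [CompleteSpace Y]
    (N : ℕ) (hN : 1 ≤ N)
    (F : ℕ → X → Y) (F' : ℕ → X → (X →L[ℝ] Y))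
    (hFcont : ∀ i < N, Continuous (F i)) (hF'cont : ∀ i < N, Continuous (F' i))
    (x₀ xstar : X) (ρ C η : ℝ) (hρ : 0 < ρ) (hC : 0 < C) (hη0 : 0 ≤ η) (hη1 : η < 1)
    (hA1 : ∀ i < N, ∀ x ∈ closedBall x₀ ρ, ‖F' i x‖ ≤ C)
    (hA2 : ∀ i < N, ∀ x ∈ closedBall x₀ ρ, ∀ x' ∈ closedBall x₀ ρ,
        ‖F i x' - F i x - F' i x (x' - x)‖ ≤ η * ‖F i x' - F i x‖)
    (y : ℕ → Y) (hA3 : xstar ∈ closedBall x₀ (ρ / 2)) (hsol : ∀ i < N, F i xstar = y i)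
    (q α τ : ℝ) (hq0 : 0 < q) (hq1 : q < 1)
    (hα : C ^ 2 * q / (1 - q) < α)
    (hτ : (1 + η) / (1 - η) < τ) (hqτ : η + (1 + η) / τ < q)
    (x h : ℕ → X)
    (hx0 : x 0 = x₀)
    (hh : ∀ k, ContinuousLinearMap.adjoint (F' (k % N) (x k)) (F' (k % N) (x k) (h k))
        + α • h k
        = ContinuousLinearMap.adjoint (F' (k % N) (x k)) (y (k % N) - F (k % N) (x k)))
    (hrec : ∀ k, x (k + 1) = x k + h k)
    :
    Summable (fun k : ℕ =>
        ‖F' (k % N) (x k) (x (k + 1) - x k) + F (k % N) (x k) - y (k % N)‖ *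
          ‖F (k % N) (x k) - y (k % N)‖) ∧
      ∑' k : ℕ, ‖F' (k % N) (x k) (x (k + 1) - x k) + F (k % N) (x k) - y (k % N)‖ *
          ‖F (k % N) (x k) - y (k % N)‖ ≤
        α * (2 * (q - η))⁻¹ * ‖x₀ - xstar‖ ^ 2 := by
  have hα0 : 0 < α := lt_of_le_of_lt (by have := sub_pos.2 hq1; positivity) hα
  have hqη : 0 < q - η := by
    have hτ0 : 0 < τ := lt_trans (by have := sub_pos.2 hη1; positivity) hτ
    have : 0 < (1 + η) / τ := by positivity
    linarith
  have hmod (k : ℕ) : k % N < N := Nat.mod_lt k hN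
  have hstar : xstar ∈ closedBall x₀ ρ := closedBall_subset_closedBall (by linarith) hA3
  have step (k : ℕ) (hk : ‖x k - xstar‖ ≤ ‖x₀ - xstar‖) :
      2 * (q - η) * (‖F' (k % N) (x k) (x (k + 1) - x k) + F (k % N) (x k) - y (k % N)‖ *
        ‖F (k % N) (x k) - y (k % N)‖) ≤
        α * (‖x k - xstar‖ ^ 2 - ‖x (k + 1) - xstar‖ ^ 2) := by
    have hxk : x k ∈ closedBall x₀ ρ := by
      rw [mem_closedBall, dist_eq_norm] at hA3 ⊢
      calc ‖x k - x₀‖ = ‖(x k - xstar) + (xstar - x₀)‖ := by rw [sub_add_sub_cancel]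
        _ ≤ ‖x k - xstar‖ + ‖xstar - x₀‖ := norm_add_le _ _
        _ ≤ ρ := by rw [norm_sub_rev x₀] at hk; linarith
    have hw : ‖F' (k % N) (x k) (x k - xstar) - (F (k % N) (x k) - y (k % N))‖ ≤
        η * ‖F (k % N) (x k) - y (k % N)‖ := by
      have := hA2 _ (hmod k) _ hxk _ hstar
      rw [hsol _ (hmod k), norm_sub_rev (y _)] at this
      convert this using 2
      rw [← neg_sub xstar, map_neg]
      abel
    have hmain := norm_add_sq_le_of_regularized_step (F' (k % N) (x k)) hC.le hq0 hq1 hα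
      (hA1 _ (hmod k) _ hxk) hw ((hh k).trans (by rw [neg_sub]))
    rwa [hrec k, add_sub_cancel_left, add_sub_assoc, add_sub_right_comm]
  have hmono (k : ℕ) : ‖x k - xstar‖ ≤ ‖x₀ - xstar‖ := by
    induction k with
    | zero => rw [hx0]
    | succ k ih =>
      refine le_trans ?_ ih
      have : 0 ≤ α * (‖x k - xstar‖ ^ 2 - ‖x (k + 1) - xstar‖ ^ 2) :=
        le_trans (by positivity) (step k ih)
      exact le_of_sq_le_sq (sub_nonneg.1 (nonneg_of_mul_nonneg_right this hα0)) (norm_nonneg _)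
  have hsum (n : ℕ) : ∑ k ∈ Finset.range n,
      ‖F' (k % N) (x k) (x (k + 1) - x k) + F (k % N) (x k) - y (k % N)‖ *
        ‖F (k % N) (x k) - y (k % N)‖ ≤ α * (2 * (q - η))⁻¹ * ‖x₀ - xstar‖ ^ 2 := by
    have htel := Finset.sum_le_sum fun k (_ : k ∈ Finset.range n) => step k (hmono k)
    rw [← Finset.mul_sum, ← Finset.mul_sum,
      Finset.sum_range_sub' (fun k => ‖x k - xstar‖ ^ 2), hx0] at htel
    rw [mul_right_comm, ← div_eq_mul_inv, le_div_iff₀' (by positivity)]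
    refine htel.trans ?_
    gcongr
    exact sub_le_self _ (sq_nonneg _)
  exact ⟨summable_of_sum_range_le (fun _ => by positivity) hsum,
    Real.tsum_le_of_sum_range_le (fun _ => by positivity) hsum⟩
end

section
/- In the exact-data case, the LMK iterates x_k converge in X, as k → ∞, to a limit x⁺ which is a solution of the system, i.e., F_i(x⁺) = y_i for all i ∈ {0,…,N−1}. -/
open Metric Filter

section LevenbergMarquardtStep

open scoped InnerProductSpace

variable {X Y : Type*} [NormedAddCommGroup X] [InnerProductSpace ℝ X] [CompleteSpace X]
  [NormedAddCommGroup Y] [InnerProductSpace ℝ Y] [CompleteSpace Y]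
  {A : X →L[ℝ] Y} {α C q η : ℝ} {h : X} {s : Y}

/-- The Levenberg–Marquardt step `h` is `α⁻¹ A*` applied to the linearized residual. -/
lemma lm_step_inner
    (hh : ContinuousLinearMap.adjoint A (A h) + α • h = ContinuousLinearMap.adjoint A s) (v : X) :
    α * ⟪h, v⟫_ℝ = ⟪s - A h, A v⟫_ℝ := by
  have h1 : α • h = ContinuousLinearMap.adjoint A (s - A h) := by
    rw [map_sub, ← hh]; abel
  rw [← real_inner_smul_left, h1, ContinuousLinearMap.adjoint_inner_left]

lemma lm_step_inner_residual
    (hh : ContinuousLinearMap.adjoint A (A h) + α • h = ContinuousLinearMap.adjoint A s) :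
    ⟪s - A h, s⟫_ℝ = ‖s - A h‖ ^ 2 + α * ‖h‖ ^ 2 := by
  have h1 := lm_step_inner hh h
  rw [real_inner_self_eq_norm_sq] at h1
  rw [h1, ← real_inner_self_eq_norm_sq, ← inner_add_right, sub_add_cancel]

/-- The linearized residual does not exceed the residual. -/
lemma lm_step_residual_le (hα : 0 < α)
    (hh : ContinuousLinearMap.adjoint A (A h) + α • h = ContinuousLinearMap.adjoint A s) :
    ‖s - A h‖ ≤ ‖s‖ := by
  have h1 := lm_step_inner_residual hh
  have h2 := real_inner_le_norm (s - A h) s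
  have h3 : 0 ≤ α * ‖h‖ ^ 2 := by positivity
  by_contra! hlt
  nlinarith [norm_nonneg s, norm_nonneg (s - A h)]

lemma lm_step_abs_inner_le (hα : 0 < α)
    (hh : ContinuousLinearMap.adjoint A (A h) + α • h = ContinuousLinearMap.adjoint A s) (v : X) :
    α * |⟪h, v⟫_ℝ| ≤ ‖s‖ * ‖A v‖ := by
  have h1 : α * |⟪h, v⟫_ℝ| = |α * ⟪h, v⟫_ℝ| := by rw [abs_mul, abs_of_pos hα]
  rw [h1, lm_step_inner hh]
  exact (abs_real_inner_le_norm _ _).trans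
    (mul_le_mul_of_nonneg_right (lm_step_residual_le hα hh) (norm_nonneg _))

lemma lm_step_norm_le_linearized (hα : 0 < α) (hA : ‖A‖ ≤ C)
    (hh : ContinuousLinearMap.adjoint A (A h) + α • h = ContinuousLinearMap.adjoint A s) :
    α * ‖h‖ ≤ C * ‖s - A h‖ := by
  have h1 : α • h = ContinuousLinearMap.adjoint A (s - A h) := by
    rw [map_sub, ← hh]; abel
  calc α * ‖h‖ = ‖α • h‖ := by rw [norm_smul, Real.norm_of_nonneg hα.le]
    _ ≤ ‖ContinuousLinearMap.adjoint A‖ * ‖s - A h‖ := by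
      rw [h1]; exact ContinuousLinearMap.le_opNorm _ _
    _ ≤ C * ‖s - A h‖ := by
      rw [LinearIsometryEquiv.norm_map]; gcongr

lemma lm_step_norm_le (hα : 0 < α) (hA : ‖A‖ ≤ C)
    (hh : ContinuousLinearMap.adjoint A (A h) + α • h = ContinuousLinearMap.adjoint A s) :
    α * ‖h‖ ≤ C * ‖s‖ :=
  (lm_step_norm_le_linearized hα hA hh).trans
    (mul_le_mul_of_nonneg_left (lm_step_residual_le hα hh) ((norm_nonneg A).trans hA))

/-- A sufficiently large regularization parameter keeps a fraction `q` of the residual. -/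
lemma lm_step_le_residual (hα : 0 < α) (hA : ‖A‖ ≤ C) (hq : 0 < q)
    (hCα : C ^ 2 * q ≤ α * (1 - q))
    (hh : ContinuousLinearMap.adjoint A (A h) + α • h = ContinuousLinearMap.adjoint A s) :
    q * ‖s‖ ≤ ‖s - A h‖ := by
  have hC : 0 ≤ C := (norm_nonneg A).trans hA
  have h1 := lm_step_norm_le_linearized hα hA hh
  have h2 : ‖A h‖ ≤ C * ‖h‖ := A.le_of_opNorm_le hA h
  have h3 : ‖s‖ ≤ ‖s - A h‖ + ‖A h‖ := by
    simpa using norm_add_le (s - A h) (A h)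
  have h4 : α * ‖A h‖ ≤ C ^ 2 * ‖s - A h‖ := by
    calc α * ‖A h‖ ≤ α * (C * ‖h‖) := by gcongr
      _ = C * (α * ‖h‖) := by ring
      _ ≤ C * (C * ‖s - A h‖) := by gcongr
      _ = _ := by ring
  refine le_of_mul_le_mul_left ?_ hα
  calc α * (q * ‖s‖) ≤ q * (α * ‖s - A h‖ + α * ‖A h‖) := by
        rw [← mul_add, mul_left_comm]; gcongr
    _ ≤ q * (α * ‖s - A h‖ + C ^ 2 * ‖s - A h‖) := by gcongr
    _ = α * q * ‖s - A h‖ + C ^ 2 * q * ‖s - A h‖ := by ring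
    _ ≤ α * q * ‖s - A h‖ + α * (1 - q) * ‖s - A h‖ := by gcongr
    _ = α * ‖s - A h‖ := by ring

/-- Monotonicity of the error along a Levenberg–Marquardt step, where `e` is the vector from the
current iterate to a solution. -/
lemma lm_step_descent (hα : 0 < α) (hA : ‖A‖ ≤ C) (hq : 0 < q) (hηq : η < q)
    (hCα : C ^ 2 * q ≤ α * (1 - q))
    (hh : ContinuousLinearMap.adjoint A (A h) + α • h = ContinuousLinearMap.adjoint A s)
    {e : X} (he : ‖s - A e‖ ≤ η * ‖s‖) :
    α * ‖h‖ ^ 2 + 2 * (q * (q - η)) * ‖s‖ ^ 2 ≤ α * (‖e‖ ^ 2 - ‖h - e‖ ^ 2) := by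
  have h1 := lm_step_inner hh e
  have h2 := lm_step_inner_residual hh
  have h3 := lm_step_le_residual hα hA hq hCα hh
  have h4 : ⟪s - A h, s⟫_ℝ - ⟪s - A h, A e⟫_ℝ ≤ ‖s - A h‖ * (η * ‖s‖) := by
    rw [← inner_sub_right]
    exact (real_inner_le_norm _ _).trans (mul_le_mul_of_nonneg_left he (norm_nonneg _))
  have h5 : q * (q - η) * ‖s‖ ^ 2 ≤ ‖s - A h‖ * (‖s - A h‖ - η * ‖s‖) := by
    calc q * (q - η) * ‖s‖ ^ 2 = (q * ‖s‖) * (q * ‖s‖ - η * ‖s‖) := by ring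
      _ ≤ _ := by
        have : 0 ≤ q * ‖s‖ - η * ‖s‖ := by
          rw [← sub_mul]; exact mul_nonneg (sub_nonneg.2 hηq.le) (norm_nonneg _)
        gcongr
  rw [norm_sub_sq_real]
  linarith

end LevenbergMarquardtStep

section Cauchy

open scoped InnerProductSpace

variable {X : Type*} [NormedAddCommGroup X] [InnerProductSpace ℝ X]

/-- A sequence whose distance to `z` decreases is Cauchy if its increments are controlled by that
decrease when tested against `a n - z`, for `n` with a comparatively small value of `R`. -/
lemma cauchySeq_of_abs_inner_le {a : ℕ → X} {z : X} {R : ℕ → ℝ} {K : ℝ}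
    (hD : ∀ l, ‖a (l + 1) - z‖ ^ 2 ≤ ‖a l - z‖ ^ 2)
    (hK : ∀ l n, R n ≤ R l → |⟪a (l + 1) - a l, a n - z⟫_ℝ| ≤
      K * (‖a l - z‖ ^ 2 - ‖a (l + 1) - z‖ ^ 2)) : CauchySeq a := by
  set D : ℕ → ℝ := fun l => ‖a l - z‖ ^ 2 with hDdef
  have hanti : Antitone D := antitone_nat_of_succ_le hD
  have hinner : ∀ {n p r : ℕ}, p ≤ r → (∀ i, p ≤ i → i < r → R n ≤ R i) →
      |⟪a r - a p, a n - z⟫_ℝ| ≤ K * (D p - D r) := by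
    intro n p r hpr
    induction r, hpr using Nat.le_induction with
    | base => simp
    | succ r hpr ih =>
      intro hR
      have h1 := ih fun i hi hir => hR i hi (by omega)
      have h2 := hK r n (hR r hpr (by omega))
      have h3 : a (r + 1) - a p = (a (r + 1) - a r) + (a r - a p) := by abel
      rw [h3, inner_add_left]
      refine (abs_add_le _ _).trans ?_
      simp only [hDdef] at h1 ⊢
      linarith
  have hsq : ∀ p n, ‖a p - a n‖ ^ 2 = D p - D n - 2 * ⟪a p - a n, a n - z⟫_ℝ := by
    intro p n
    have h1 : a p - z = (a p - a n) + (a n - z) := by abel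
    simp only [hDdef]
    rw [h1, norm_add_sq_real]
    ring
  have hmain : ∀ {l m}, l ≤ m → dist (a l) (a m) ^ 2 ≤ (2 + 4 * K) * (D l - D m) := by
    intro l m hlm
    obtain ⟨n, hn, hmin⟩ := Finset.exists_min_image (Finset.Icc l m) R ⟨l, by simp [hlm]⟩
    rw [Finset.mem_Icc] at hn
    have h1 := abs_le.1 (hinner (n := n) hn.2 fun i hi hi' =>
      hmin i (Finset.mem_Icc.2 ⟨hn.1.trans hi, hi'.le⟩))
    have h2 := abs_le.1 (hinner (n := n) hn.1 fun i hi hi' =>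
      hmin i (Finset.mem_Icc.2 ⟨hi, hi'.le.trans hn.2⟩))
    have h3 := hsq m n
    have h4 := hsq l n
    rw [← neg_sub (a n) (a l), inner_neg_left, norm_neg] at h4
    have h5 := hanti hn.1
    have h6 := hanti hn.2
    have h7 : dist (a l) (a m) ≤ ‖a n - a l‖ + ‖a m - a n‖ := by
      rw [dist_comm, dist_eq_norm, add_comm]
      exact norm_sub_le_norm_sub_add_norm_sub _ _ _
    have h8 : dist (a l) (a m) ^ 2 ≤ (‖a n - a l‖ + ‖a m - a n‖) ^ 2 := by gcongr
    nlinarith [sq_nonneg (‖a n - a l‖ - ‖a m - a n‖)]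
  have hbdd : BddBelow (Set.range D) := ⟨0, by rintro _ ⟨l, rfl⟩; positivity⟩
  have hlim := tendsto_atTop_ciInf hanti hbdd
  set L := ⨅ l, D l
  have hb : Tendsto (fun l => √(|2 + 4 * K| * (D l - L))) atTop (nhds 0) := by
    have := ((hlim.sub_const L).const_mul |2 + 4 * K|).sqrt
    simpa using this
  refine cauchySeq_of_le_tendsto_0' _ (fun l m hlm => ?_) hb
  refine Real.le_sqrt_of_sq_le ((hmain hlm).trans ?_)
  have h1 := hanti hlm
  have h2 : L ≤ D m := ciInf_le hbdd m
  calc (2 + 4 * K) * (D l - D m) ≤ |2 + 4 * K| * (D l - D m) :=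
        mul_le_mul_of_nonneg_right (le_abs_self _) (by linarith)
    _ ≤ _ := by gcongr

end Cauchy

/-- convergence for exact data: the LMK iterates converge to a solution
`x⁺` of the system `F_i(x⁺) = y_i`, `i = 0, …, N-1`. -/
theorem stmt_12
    {X Y : Type*} [NormedAddCommGroup X] [InnerProductSpace ℝ X] [CompleteSpace X]
    [NormedAddCommGroup Y] [InnerProductSpace ℝ Y] [CompleteSpace Y]
    (N : ℕ) (hN : 1 ≤ N)
    (F : ℕ → X → Y) (F' : ℕ → X → (X →L[ℝ] Y))
    (hFcont : ∀ i < N, Continuous (F i)) (hF'cont : ∀ i < N, Continuous (F' i))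
    (x₀ xstar : X) (ρ C η : ℝ) (hρ : 0 < ρ) (hC : 0 < C) (hη0 : 0 ≤ η) (hη1 : η < 1)
    (hA1 : ∀ i < N, ∀ x ∈ closedBall x₀ ρ, ‖F' i x‖ ≤ C)
    (hA2 : ∀ i < N, ∀ x ∈ closedBall x₀ ρ, ∀ x' ∈ closedBall x₀ ρ,
        ‖F i x' - F i x - F' i x (x' - x)‖ ≤ η * ‖F i x' - F i x‖)
    (y : ℕ → Y) (hA3 : xstar ∈ closedBall x₀ (ρ / 2)) (hsol : ∀ i < N, F i xstar = y i)
    (q α τ : ℝ) (hq0 : 0 < q) (hq1 : q < 1)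
    (hα : C ^ 2 * q / (1 - q) < α)
    (hτ : (1 + η) / (1 - η) < τ) (hqτ : η + (1 + η) / τ < q)
    (x h : ℕ → X)
    (hx0 : x 0 = x₀)
    (hh : ∀ k, ContinuousLinearMap.adjoint (F' (k % N) (x k)) (F' (k % N) (x k) (h k))
        + α • h k
        = ContinuousLinearMap.adjoint (F' (k % N) (x k)) (y (k % N) - F (k % N) (x k)))
    (hrec : ∀ k, x (k + 1) = x k + h k)
    :
    ∃ xp : X, Tendsto x atTop (nhds xp) ∧ ∀ i < N, F i xp = y i := by
  have hτ0 : 0 < τ := lt_trans (div_pos (by linarith) (by linarith)) hτ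
  have hηq : η < q := by
    have : 0 < (1 + η) / τ := div_pos (by linarith) hτ0
    linarith
  have hα0 : 0 < α := lt_of_le_of_lt (div_nonneg (by positivity) (by linarith)) hα
  have hCα : C ^ 2 * q ≤ α * (1 - q) := ((div_lt_iff₀ (by linarith)).1 hα).le
  have hmod : ∀ k, k % N < N := fun k => Nat.mod_lt k hN
  have hstar : xstar ∈ closedBall x₀ ρ := closedBall_subset_closedBall (by linarith) hA3
  set c : ℝ := 2 * (q * (q - η)) with hc
  have hc0 : 0 < c := by have := sub_pos.2 hηq; positivity
  set r : ℕ → ℝ := fun k => ‖y (k % N) - F (k % N) (x k)‖ with hr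
  have hr0 : ∀ k, 0 ≤ r k := fun k => norm_nonneg _
  have hdesc : ∀ z ∈ closedBall x₀ ρ, (∀ i < N, F i z = y i) → ∀ k, x k ∈ closedBall x₀ ρ →
      α * ‖h k‖ ^ 2 + c * r k ^ 2 ≤ α * (‖x k - z‖ ^ 2 - ‖x (k + 1) - z‖ ^ 2) := by
    intro z hz hzsol k hk
    have h1 := hA2 _ (hmod k) (x k) hk z hz
    rw [hzsol _ (hmod k)] at h1
    have h2 := lm_step_descent hα0 (hA1 _ (hmod k) _ hk) hq0 hηq hCα (hh k) h1
    rw [norm_sub_rev z, show h k - (z - x k) = x (k + 1) - z by rw [hrec]; abel] at h2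
    exact h2
  have hmono : ∀ z ∈ closedBall x₀ ρ, (∀ i < N, F i z = y i) → ∀ k, x k ∈ closedBall x₀ ρ →
      ‖x (k + 1) - z‖ ≤ ‖x k - z‖ := by
    intro z hz hzsol k hk
    have h1 := hdesc z hz hzsol k hk
    have h2 : 0 ≤ α * ‖h k‖ ^ 2 + c * r k ^ 2 := by positivity
    have h3 := nonneg_of_mul_nonneg_right (h2.trans h1) hα0
    exact le_of_sq_le_sq (by linarith) (norm_nonneg _)
  have hball : ∀ k, ‖x k - xstar‖ ≤ ρ / 2 → x k ∈ closedBall x₀ ρ := by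
    intro k hk
    rw [mem_closedBall] at hA3 ⊢
    have := dist_triangle (x k) xstar x₀
    rw [dist_eq_norm (x k) xstar] at this
    linarith
  have hhalf : ∀ k, ‖x k - xstar‖ ≤ ρ / 2 := by
    intro k
    induction k with
    | zero => rw [hx0, ← dist_eq_norm, dist_comm]; exact hA3
    | succ k ih => exact (hmono xstar hstar hsol k (hball k ih)).trans ih
  have hmem : ∀ k, x k ∈ closedBall x₀ ρ := fun k => hball k (hhalf k)
  have hstep : ∀ k, ‖h k‖ ≤ C / α * r k := by
    intro k
    have := lm_step_norm_le hα0 (hA1 _ (hmod k) _ (hmem k)) (hh k)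
    rw [div_mul_eq_mul_div, le_div_iff₀ hα0, mul_comm]
    exact this
  -- The tangential cone condition gives Lipschitz bounds in both directions.
  have hlin : ∀ i < N, ∀ u ∈ closedBall x₀ ρ, ∀ v ∈ closedBall x₀ ρ,
      ‖F' i u (v - u)‖ ≤ (1 + η) * ‖F i v - F i u‖ := by
    intro i hi u hu v hv
    have h1 := hA2 i hi u hu v hv
    have h2 := norm_sub_le (F i v - F i u) (F i v - F i u - F' i u (v - u))
    rw [sub_sub_cancel] at h2
    linarith
  have hlip : ∀ i < N, ∀ u ∈ closedBall x₀ ρ, ∀ v ∈ closedBall x₀ ρ,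
      ‖F i v - F i u‖ ≤ C / (1 - η) * ‖v - u‖ := by
    intro i hi u hu v hv
    have h1 := hA2 i hi u hu v hv
    have h2 := (F' i u).le_of_opNorm_le (hA1 i hi u hu) (v - u)
    have h3 := norm_add_le (F i v - F i u - F' i u (v - u)) (F' i u (v - u))
    rw [sub_add_cancel] at h3
    rw [div_mul_eq_mul_div, le_div_iff₀ (by linarith)]
    linarith
  set R : ℕ → ℝ := fun l => ∑ j ∈ Finset.range N, r (l * N + j) with hR
  have hR0 : ∀ l, 0 ≤ R l := fun l => Finset.sum_nonneg fun j _ => hr0 _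
  have hrR : ∀ l, ∀ j < N, r (l * N + j) ≤ R l := fun l j hj =>
    Finset.single_le_sum (f := fun j => r (l * N + j)) (fun j _ => hr0 _) (Finset.mem_range.2 hj)
  have hblock : ∀ l j, x (l * N + j) - x (l * N) = ∑ i ∈ Finset.range j, h (l * N + i) := by
    intro l j
    induction j with
    | zero => simp
    | succ j ih => rw [Finset.sum_range_succ, ← ih, ← add_assoc, hrec]; abel
  have hmodj : ∀ l, ∀ j < N, (l * N + j) % N = j := fun l j hj => by
    rw [Nat.mul_add_mod', Nat.mod_eq_of_lt hj]
  have hdiam : ∀ l, ∀ j < N, ‖x (l * N + j) - x (l * N)‖ ≤ C / α * R l := by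
    intro l j hj
    rw [hblock, hR, Finset.mul_sum]
    refine (norm_sum_le _ _).trans ((Finset.sum_le_sum fun i _ => hstep _).trans ?_)
    refine Finset.sum_le_sum_of_subset_of_nonneg (Finset.range_mono hj.le) fun i _ _ => ?_
    have := hr0 (l * N + i)
    positivity
  set K : ℝ := 1 + C / (1 - η) * (C / α) with hKdef
  have hη1' : 0 < 1 - η := by linarith
  have hK0 : 0 ≤ K := by positivity
  have hres : ∀ n, ∀ j < N, ‖F j (x (n * N)) - y j‖ ≤ K * R n := by
    intro n j hj
    have h1 := hlip j hj _ (hmem (n * N)) _ (hmem (n * N + j))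
    have h2 := hrR n j hj
    simp only [hr, hmodj n j hj] at h2
    have h3 : C / (1 - η) * ‖x (n * N + j) - x (n * N)‖ ≤ C / (1 - η) * (C / α * R n) :=
      mul_le_mul_of_nonneg_left (hdiam n j hj) (by positivity)
    have h4 := norm_add_le (y j - F j (x (n * N + j))) (F j (x (n * N + j)) - F j (x (n * N)))
    rw [sub_add_sub_cancel, norm_sub_rev] at h4
    calc _ ≤ R n + C / (1 - η) * (C / α * R n) := by linarith
      _ = K * R n := by ring
  have hinner : ∀ l n, R n ≤ R l → ∀ j < N,
      |inner ℝ (h (l * N + j)) (x (n * N) - xstar)| ≤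
        (1 + η) * (2 + K) / α * R l * r (l * N + j) := by
    intro l n hnl j hj
    set k := l * N + j with hk
    have hkj : k % N = j := hmodj l j hj
    have h1 := lm_step_abs_inner_le hα0 (hh k) (x (n * N) - xstar)
    have h2 := hlin (k % N) (hmod k) _ (hmem k) _ (hmem (n * N))
    have h3 := hlin (k % N) (hmod k) _ (hmem k) _ hstar
    rw [hsol _ (hmod k)] at h3
    have h4 := norm_sub_le (F' (k % N) (x k) (x (n * N) - x k)) (F' (k % N) (x k) (xstar - x k))
    rw [← map_sub, sub_sub_sub_cancel_right] at h4
    have h5 := norm_add_le (F (k % N) (x (n * N)) - y (k % N)) (y (k % N) - F (k % N) (x k))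
    rw [sub_add_sub_cancel] at h5
    have h6 := hres n (k % N) (hmod k)
    have h7 : K * R n ≤ K * R l := by gcongr
    have h8 : r k ≤ R l := hrR l j hj
    have h9 : ‖F' (k % N) (x k) (x (n * N) - xstar)‖ ≤ (1 + η) * ((2 + K) * R l) := by
      change _ ≤ _ * r k at h3
      change _ ≤ _ + r k at h5
      have : (1 + η) * (‖F (k % N) (x (n * N)) - F (k % N) (x k)‖ + r k) ≤
          (1 + η) * ((2 + K) * R l) := by
        gcongr
        linarith
      linarith
    have h10 : α * |inner ℝ (h k) (x (n * N) - xstar)| ≤ r k * ((1 + η) * ((2 + K) * R l)) :=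
      h1.trans (mul_le_mul_of_nonneg_left h9 (hr0 k))
    refine le_of_mul_le_mul_left (h10.trans_eq ?_) hα0
    field_simp
  have hsum : ∀ l, ∑ j ∈ Finset.range N, c * r (l * N + j) ^ 2 ≤
      α * (‖x (l * N) - xstar‖ ^ 2 - ‖x ((l + 1) * N) - xstar‖ ^ 2) := by
    intro l
    have h1 := Finset.sum_range_sub' (fun j => ‖x (l * N + j) - xstar‖ ^ 2) N
    rw [add_zero] at h1
    rw [show (l + 1) * N = l * N + N by ring, ← h1, Finset.mul_sum]
    refine Finset.sum_le_sum fun j _ => ?_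
    have h2 := hdesc xstar hstar hsol (l * N + j) (hmem _)
    have h3 : 0 ≤ α * ‖h (l * N + j)‖ ^ 2 := by positivity
    rw [← add_assoc]
    linarith
  have hRsq : ∀ l, R l ^ 2 ≤
      N * α / c * (‖x (l * N) - xstar‖ ^ 2 - ‖x ((l + 1) * N) - xstar‖ ^ 2) := by
    intro l
    have h1 := sq_sum_le_card_mul_sum_sq (s := Finset.range N) (f := fun j => r (l * N + j))
    rw [Finset.card_range] at h1
    have h2 := hsum l
    rw [← Finset.mul_sum] at h2
    refine h1.trans ?_
    rw [div_mul_eq_mul_div, le_div_iff₀ hc0]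
    have h3 := mul_le_mul_of_nonneg_left h2 (Nat.cast_nonneg (α := ℝ) N)
    linarith
  have hcauchy : CauchySeq fun l => x (l * N) := by
    refine cauchySeq_of_abs_inner_le (z := xstar) (R := R)
      (K := (1 + η) * (2 + K) / α * (N * α / c)) (fun l => ?_) fun l n hnl => ?_
    · have h1 := (sq_nonneg (R l)).trans (hRsq l)
      have hN0 : (0 : ℝ) < N := Nat.cast_pos.2 hN
      have h2 := nonneg_of_mul_nonneg_right h1 (by positivity)
      linarith
    · rw [show (l + 1) * N = l * N + N by ring, hblock, sum_inner,
        show l * N + N = (l + 1) * N by ring]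
      calc _ ≤ ∑ j ∈ Finset.range N, (1 + η) * (2 + K) / α * R l * r (l * N + j) :=
            (Finset.abs_sum_le_sum_abs _ _).trans
              (Finset.sum_le_sum fun j hj => hinner l n hnl j (Finset.mem_range.1 hj))
        _ = (1 + η) * (2 + K) / α * R l ^ 2 := by rw [← Finset.mul_sum]; ring
        _ ≤ _ := by
          rw [mul_assoc (_ / α)]
          exact mul_le_mul_of_nonneg_left (hRsq l) (by positivity)
  obtain ⟨xp, hxp⟩ := cauchySeq_tendsto_of_complete hcauchy
  have hRlim : Tendsto R atTop (nhds 0) := by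
    have hD : Tendsto (fun l => ‖x (l * N) - xstar‖ ^ 2) atTop (nhds (‖xp - xstar‖ ^ 2)) :=
      (hxp.sub_const xstar).norm.pow 2
    have h1 := ((hD.sub (hD.comp (tendsto_add_atTop_nat 1))).const_mul (N * α / c)).sqrt
    rw [sub_self, mul_zero, Real.sqrt_zero] at h1
    exact squeeze_zero hR0 (fun l => Real.le_sqrt_of_sq_le (hRsq l)) h1
  have hxpball : xp ∈ closedBall x₀ ρ :=
    isClosed_closedBall.mem_of_tendsto hxp (Eventually.of_forall fun l => hmem _)
  have hxpsol : ∀ i < N, F i xp = y i := by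
    intro i hi
    have h1 : Tendsto (fun l => F i (x (l * N)) - y i) atTop (nhds 0) :=
      squeeze_zero_norm (fun l => hres l i hi) (by simpa using hRlim.const_mul K)
    have h2 := (((hFcont i hi).tendsto xp).comp hxp).sub_const (y i)
    exact sub_eq_zero.1 (tendsto_nhds_unique h2 h1)
  refine ⟨xp, ?_, hxpsol⟩
  have hanti : Antitone fun k => ‖x k - xp‖ :=
    antitone_nat_of_succ_le fun k => hmono xp hxpball hxpsol k (hmem k)
  have hsub : Tendsto (fun l : ℕ => l * N) atTop atTop :=
    tendsto_id.atTop_mul_const' hN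
  rw [tendsto_iff_norm_sub_tendsto_zero] at hxp ⊢
  exact (tendsto_iff_tendsto_subseq_of_antitone hanti hsub).2 hxp
end

section
/- Assume δ_min := min{δ₀, …, δ_{N−1}} > 0. Then the stopping index k*^δ is well defined (i.e., there exists l ∈ ℕ with x_{lN}^δ = x_{lN+1}^δ = ⋯ = x_{lN+N}^δ), and it satisfies the quantitative bound k*^δ ≤ α N ‖x₀ − x*‖² / ( 2 q τ [ τ(q − η) − (1 + η) ] δ_min² ); in particular k*^δ = O(δ_min^{−2}). -/
open Metric Filter

/-- The residual of a Levenberg–Marquardt step is bounded below by the current residual. -/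
theorem lm_residual_lower_bound
    {X Y : Type*} [NormedAddCommGroup X] [InnerProductSpace ℝ X] [CompleteSpace X]
    [NormedAddCommGroup Y] [InnerProductSpace ℝ Y] [CompleteSpace Y]
    (A : X →L[ℝ] Y) (h : X) (r : Y) {C q α : ℝ}
    (hA : ‖A‖ ≤ C) (hα : 0 < α) (hqα : q * (α + C ^ 2) ≤ α)
    (hh : ContinuousLinearMap.adjoint A (A h) + α • h = ContinuousLinearMap.adjoint A r) :
    q * ‖r‖ ≤ ‖A h - r‖ := by
  have hC : 0 ≤ C := (norm_nonneg _).trans hA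
  have hαh : α • h = - ContinuousLinearMap.adjoint A (A h - r) := by
    rw [map_sub, ← hh]; abel
  have hr : α • r = -(α • (A h - r) + A (ContinuousLinearMap.adjoint A (A h - r))) := by
    have := congrArg A hαh
    rw [map_smul, map_neg] at this
    rw [smul_sub, this]; abel
  have h1 : ‖A (ContinuousLinearMap.adjoint A (A h - r))‖ ≤ C * (C * ‖A h - r‖) := by
    refine (A.le_of_opNorm_le hA _).trans (mul_le_mul_of_nonneg_left ?_ hC)
    exact ContinuousLinearMap.le_of_opNorm_le _
      ((LinearIsometryEquiv.norm_map ContinuousLinearMap.adjoint A).le.trans hA) _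
  have h2 : α * ‖r‖ ≤ (α + C ^ 2) * ‖A h - r‖ := by
    have := congrArg norm hr
    rw [norm_smul, norm_neg, Real.norm_of_nonneg hα.le] at this
    have h3 := norm_add_le (α • (A h - r)) (A (ContinuousLinearMap.adjoint A (A h - r)))
    rw [norm_smul, Real.norm_of_nonneg hα.le] at h3
    linarith
  have hpos : 0 < α + C ^ 2 := by positivity
  have h4 : (α + C ^ 2) * (q * ‖r‖) ≤ (α + C ^ 2) * ‖A h - r‖ := by
    linarith [mul_le_mul_of_nonneg_right hqα (norm_nonneg r)]
  exact le_of_mul_le_mul_left h4 hpos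

/-- Quantitative decrease of the squared error in a Levenberg–Marquardt step. -/
theorem lm_step_decrease
    {X Y : Type*} [NormedAddCommGroup X] [InnerProductSpace ℝ X] [CompleteSpace X]
    [NormedAddCommGroup Y] [InnerProductSpace ℝ Y] [CompleteSpace Y]
    (A : X →L[ℝ] Y) (e h : X) (r : Y) {C q α s : ℝ}
    (hA : ‖A‖ ≤ C) (hα : 0 < α) (hqα : q * (α + C ^ 2) ≤ α)
    (hh : ContinuousLinearMap.adjoint A (A h) + α • h = ContinuousLinearMap.adjoint A r)
    (hs : ‖r + A e‖ ≤ s) (hsq : s ≤ q * ‖r‖) :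
    ‖e + h‖ ^ 2 + 2 * (q * ‖r‖ * (q * ‖r‖ - s)) / α ≤ ‖e‖ ^ 2 := by
  have hB := lm_residual_lower_bound A h r hA hα hqα hh
  set B := A h - r with hBdef
  have hαh : α • h = - ContinuousLinearMap.adjoint A B := by
    rw [hBdef, map_sub, ← hh]; abel
  have hin : α * inner ℝ h (e + h) = - (‖B‖ ^ 2 + inner ℝ B (r + A e)) := by
    rw [← real_inner_smul_left, hαh, inner_neg_left, ContinuousLinearMap.adjoint_inner_left,
      ← real_inner_self_eq_norm_sq, ← inner_add_right]
    congr 2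
    rw [hBdef, map_add]; abel
  have hcs : -(‖B‖ * s) ≤ inner ℝ B (r + A e) := by
    have h1 := neg_le_of_abs_le (abs_real_inner_le_norm B (r + A e))
    linarith [mul_le_mul_of_nonneg_left hs (norm_nonneg B)]
  have hmul : q * ‖r‖ * (q * ‖r‖ - s) ≤ ‖B‖ * (‖B‖ - s) :=
    mul_le_mul hB (by linarith) (by linarith) (norm_nonneg _)
  have hexp : ‖e‖ ^ 2 = ‖e + h‖ ^ 2 - 2 * inner ℝ h (e + h) + ‖h‖ ^ 2 := by
    have := norm_sub_sq_real (e + h) h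
    rwa [add_sub_cancel_right, real_inner_comm] at this
  have hdiv : 2 * (q * ‖r‖ * (q * ‖r‖ - s)) / α ≤ - (2 * inner ℝ h (e + h)) := by
    rw [div_le_iff₀ hα]
    nlinarith
  nlinarith [sq_nonneg ‖h‖]

/-- if `δ_min = min δᵢ > 0`, then the stopping index `k*^δ` is well defined
(there is a cycle on which the iterates are constant), and the minimal such index `l·N`
satisfies `l·N ≤ α N ‖x₀ - x*‖² / (2 q τ (τ(q - η) - (1 + η)) δ_min²)`. -/
theorem stmt_14
    {X Y : Type*} [NormedAddCommGroup X] [InnerProductSpace ℝ X] [CompleteSpace X]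
    [NormedAddCommGroup Y] [InnerProductSpace ℝ Y] [CompleteSpace Y]
    (N : ℕ) (hN : 1 ≤ N)
    (F : ℕ → X → Y) (F' : ℕ → X → (X →L[ℝ] Y))
    (hFcont : ∀ i < N, Continuous (F i)) (hF'cont : ∀ i < N, Continuous (F' i))
    (x₀ xstar : X) (ρ C η : ℝ) (hρ : 0 < ρ) (hC : 0 < C) (hη0 : 0 ≤ η) (hη1 : η < 1)
    (hA1 : ∀ i < N, ∀ x ∈ closedBall x₀ ρ, ‖F' i x‖ ≤ C)
    (hA2 : ∀ i < N, ∀ x ∈ closedBall x₀ ρ, ∀ x' ∈ closedBall x₀ ρ,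
        ‖F i x' - F i x - F' i x (x' - x)‖ ≤ η * ‖F i x' - F i x‖)
    (y : ℕ → Y) (hA3 : xstar ∈ closedBall x₀ (ρ / 2)) (hsol : ∀ i < N, F i xstar = y i)
    (δ : ℕ → ℝ) (hδ : ∀ i < N, 0 ≤ δ i)
    (yδ : ℕ → Y) (hnoise : ∀ i < N, ‖yδ i - y i‖ ≤ δ i)
    (q α τ : ℝ) (hq0 : 0 < q) (hq1 : q < 1)
    (hα : C ^ 2 * q / (1 - q) < α)
    (hτ : (1 + η) / (1 - η) < τ) (hqτ : η + (1 + η) / τ < q)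
    (x h : ℕ → X) (ω : ℕ → ℝ)
    (hx0 : x 0 = x₀)
    (hω : ∀ k, ω k = if τ * δ (k % N) ≤ ‖F (k % N) (x k) - yδ (k % N)‖ then 1 else 0)
    (hh : ∀ k, ContinuousLinearMap.adjoint (F' (k % N) (x k)) (F' (k % N) (x k) (h k))
        + α • h k
        = ContinuousLinearMap.adjoint (F' (k % N) (x k)) (yδ (k % N) - F (k % N) (x k)))
    (hrec : ∀ k, x (k + 1) = x k + ω k • h k)
    (δmin : ℝ) (hδmin_pos : 0 < δmin) (hδmin_le : ∀ i < N, δmin ≤ δ i)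
    (hδmin_mem : ∃ i < N, δ i = δmin)
    :
    ∃ l : ℕ, (∀ m ≤ N, x (l * N + m) = x (l * N)) ∧
      (∀ l' : ℕ, (∀ m ≤ N, x (l' * N + m) = x (l' * N)) → l ≤ l') ∧
      ((l * N : ℝ) ≤
        α * N * ‖x₀ - xstar‖ ^ 2 /
          (2 * q * τ * (τ * (q - η) - (1 + η)) * δmin ^ 2)) := by
  classical
  have hη : 0 < 1 - η := by linarith
  have hτ0 : 0 < τ := lt_of_le_of_lt (by positivity) hτ
  have hα0 : 0 < α := lt_of_le_of_lt (by have := sub_pos.2 hq1; positivity) hα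
  have hqα : q * (α + C ^ 2) ≤ α := by
    rw [div_lt_iff₀ (by linarith)] at hα
    linarith
  have hgap : 0 < τ * (q - η) - (1 + η) := by
    have : (1 + η) / τ < q - η := by linarith
    rw [div_lt_iff₀ hτ0] at this
    linarith
  set K := 2 * q * τ * (τ * (q - η) - (1 + η)) * δmin ^ 2 with hK
  have hK0 : 0 < K := by positivity
  have hR : ‖x₀ - xstar‖ ≤ ρ / 2 := by
    rw [← dist_eq_norm, dist_comm]; exact mem_closedBall.1 hA3
  have hsball : xstar ∈ closedBall x₀ ρ := closedBall_subset_closedBall (by linarith) hA3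
  have hstep : ∀ k, ‖x k - xstar‖ ≤ ‖x₀ - xstar‖ →
      ‖x (k + 1) - xstar‖ ^ 2 + (if x (k + 1) = x k then 0 else K / α)
        ≤ ‖x k - xstar‖ ^ 2 := by
    intro k hk
    have hiN : k % N < N := Nat.mod_lt _ hN
    set i := k % N with hi
    by_cases hact : τ * δ i ≤ ‖F i (x k) - yδ i‖
    swap
    · have : x (k + 1) = x k := by rw [hrec, hω, if_neg hact, zero_smul, add_zero]
      simp [this]
    have hxk : x k ∈ closedBall x₀ ρ := by
      rw [mem_closedBall, dist_eq_norm]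
      have := norm_sub_le_norm_sub_add_norm_sub (x k) xstar x₀
      rw [norm_sub_rev xstar] at this
      linarith
    have hx1 : x (k + 1) - xstar = (x k - xstar) + h k := by
      rw [hrec, hω, if_pos hact, one_smul]; abel
    set r := yδ i - F i (x k) with hr
    rw [norm_sub_rev, ← hr] at hact
    have hlin : ‖r + F' i (x k) (x k - xstar)‖ ≤ (1 + η) * δ i + η * ‖r‖ := by
      have h1 := hA2 i hiN (x k) hxk xstar hsball
      rw [hsol i hiN] at h1
      have h2 : r + F' i (x k) (x k - xstar)
          = (yδ i - y i) + (y i - F i (x k) - F' i (x k) (xstar - x k)) := by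
        rw [← neg_sub xstar (x k), map_neg, hr]; abel
      have h3 : ‖y i - F i (x k)‖ ≤ ‖r‖ + δ i := by
        have : y i - F i (x k) = r - (yδ i - y i) := by rw [hr]; abel
        rw [this]
        exact (norm_sub_le _ _).trans (by linarith [hnoise i hiN])
      rw [h2]
      refine (norm_add_le _ _).trans ?_
      linarith [hnoise i hiN, mul_le_mul_of_nonneg_left h3 hη0]
    have hδi := hδmin_le i hiN
    have hqη : 0 < q - η := by
      have : 0 < τ * (q - η) := by linarith
      exact pos_of_mul_pos_right this hτ0.le
    have hdiff : (τ * (q - η) - (1 + η)) * δmin ≤ q * ‖r‖ - ((1 + η) * δ i + η * ‖r‖) := by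
      linarith [mul_le_mul_of_nonneg_left hact hqη.le, mul_le_mul_of_nonneg_left hδi hgap.le]
    have hnn : 0 ≤ (τ * (q - η) - (1 + η)) * δmin := by positivity
    have hdec := lm_step_decrease (F' i (x k)) (x k - xstar) (h k) r (hA1 i hiN _ hxk) hα0
      hqα (hh k) hlin (by linarith)
    have hKle : K ≤ 2 * (q * ‖r‖ * (q * ‖r‖ - ((1 + η) * δ i + η * ‖r‖))) := by
      have h1 : τ * δmin ≤ ‖r‖ := (mul_le_mul_of_nonneg_left hδi hτ0.le).trans hact
      have h2 := mul_le_mul (mul_le_mul_of_nonneg_left h1 hq0.le) hdiff hnn (by positivity)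
      rw [hK]
      linarith
    have hKdiv := div_le_div_of_nonneg_right hKle hα0.le
    rw [hx1]
    have hKα : 0 < K / α := by positivity
    split_ifs <;> linarith
  have hbound : ∀ k, ‖x k - xstar‖ ≤ ‖x₀ - xstar‖ := by
    intro k
    induction k with
    | zero => rw [hx0]
    | succ k ih =>
      have h1 := hstep k ih
      have hKα : 0 < K / α := by positivity
      have h2 : ‖x (k + 1) - xstar‖ ^ 2 ≤ ‖x k - xstar‖ ^ 2 := by
        split_ifs at h1 <;> linarith
      exact (pow_le_pow_iff_left₀ (norm_nonneg _) (norm_nonneg _) two_ne_zero |>.1 h2).trans ih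
  have hsteps : ∀ k m, ‖x (k + m) - xstar‖ ^ 2
      + (if ∀ j ≤ m, x (k + j) = x k then 0 else K / α) ≤ ‖x k - xstar‖ ^ 2 := by
    intro k m
    have hKα : 0 < K / α := by positivity
    induction m with
    | zero => simp
    | succ m ih =>
      have h1 := hstep (k + m) (hbound _)
      rw [← add_assoc]
      by_cases hc : ∀ j ≤ m, x (k + j) = x k
      · by_cases he : x (k + m + 1) = x (k + m)
        · have : ∀ j ≤ m + 1, x (k + j) = x k := by
            intro j hj
            rcases Nat.le_succ_iff.1 hj with hj | rfl
            · exact hc j hj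
            · exact he.trans (hc m le_rfl)
          rw [if_pos hc] at ih
          rw [if_pos he] at h1
          rw [if_pos this]
          linarith
        · rw [if_neg he] at h1
          rw [if_pos hc] at ih
          split_ifs <;> linarith
      · rw [if_neg hc] at ih
        split_ifs at h1 ⊢ <;> linarith
  have hcycles : ∀ l : ℕ, (∀ l' < l, ¬ ∀ m ≤ N, x (l' * N + m) = x (l' * N)) →
      ‖x (l * N) - xstar‖ ^ 2 + l * (K / α) ≤ ‖x₀ - xstar‖ ^ 2 := by
    intro l
    induction l with
    | zero => simp [hx0]
    | succ l ih =>
      intro hl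
      have h1 := ih fun l' hl' => hl l' (by omega)
      have h2 := hsteps (l * N) N
      rw [if_neg (hl l (by omega))] at h2
      rw [Nat.succ_mul]
      push_cast
      linarith
  have hcount : ∀ l : ℕ, (∀ l' < l, ¬ ∀ m ≤ N, x (l' * N + m) = x (l' * N)) →
      (l : ℝ) ≤ α * ‖x₀ - xstar‖ ^ 2 / K := by
    intro l hl
    have h1 : (l : ℝ) * (K / α) ≤ ‖x₀ - xstar‖ ^ 2 := by
      linarith [hcycles l hl, sq_nonneg ‖x (l * N) - xstar‖]
    rw [← mul_div_assoc, div_le_iff₀ hα0] at h1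
    rw [le_div_iff₀ hK0]
    linarith
  have hex : ∃ l : ℕ, ∀ m ≤ N, x (l * N + m) = x (l * N) := by
    by_contra hcon
    obtain ⟨n, hn⟩ := exists_nat_gt (α * ‖x₀ - xstar‖ ^ 2 / K)
    exact absurd (hcount n fun l' _ h' => hcon ⟨l', h'⟩) (not_le.2 hn)
  refine ⟨Nat.find hex, Nat.find_spec hex, fun l' hl' => Nat.find_min' hex hl', ?_⟩
  have h1 := hcount _ fun l' hl' => Nat.find_min hex hl'
  calc (Nat.find hex : ℝ) * N ≤ α * ‖x₀ - xstar‖ ^ 2 / K * N :=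
        mul_le_mul_of_nonneg_right h1 (Nat.cast_nonneg N)
    _ = α * N * ‖x₀ - xstar‖ ^ 2 / K := by ring
end

section
/- (Stability) Let δ_j = (δ_{j,0}, …, δ_{j,N−1}) ∈ (0,∞)^N be a sequence of noise-level vectors with δ_j → 0 as j → ∞, and let y^{δ_j} = (y_0^{δ_j}, …, y_{N−1}^{δ_j}) ∈ Y^N be corresponding noisy data with ‖y_i^{δ_j} − y_i‖ ≤ δ_{j,i} for all i and j. Denote by x_k^{δ_j} the l-LMK iterates computed with data y^{δ_j} and noise levels δ_j, and by x_k the exact-data LMK iterates. Then for each fixed k ∈ ℕ, x_k^{δ_j} → x_k as j → ∞. -/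
open Metric Filter

open ContinuousLinearMap in
/-- The regularized normal operator `A* A + α I` is bounded below by `α`. -/
theorem mul_norm_le_norm_adjoint_apply_add_smul
    {X Y : Type*} [NormedAddCommGroup X] [InnerProductSpace ℝ X] [CompleteSpace X]
    [NormedAddCommGroup Y] [InnerProductSpace ℝ Y] [CompleteSpace Y]
    (A : X →L[ℝ] Y) (α : ℝ) (v : X) :
    α * ‖v‖ ≤ ‖adjoint A (A v) + α • v‖ := by
  rcases eq_or_ne v 0 with rfl | hv
  · simp
  have hv' : 0 < ‖v‖ := norm_pos_iff.mpr hv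
  have hinner : inner ℝ (adjoint A (A v) + α • v) v = ‖A v‖ ^ 2 + α * ‖v‖ ^ 2 := by
    rw [inner_add_left, adjoint_inner_left, real_inner_smul_left,
      real_inner_self_eq_norm_sq, real_inner_self_eq_norm_sq]
  have hcs := real_inner_le_norm (adjoint A (A v) + α • v) v
  rw [hinner] at hcs
  refine le_of_mul_le_mul_right ?_ hv'
  nlinarith [sq_nonneg ‖A v‖]

open ContinuousLinearMap in
/-- Regularized least-squares solutions depend continuously on the operator and the data. -/
theorem tendsto_of_adjoint_apply_add_smul_eq
    {X Y ι : Type*} [NormedAddCommGroup X] [InnerProductSpace ℝ X] [CompleteSpace X]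
    [NormedAddCommGroup Y] [InnerProductSpace ℝ Y] [CompleteSpace Y]
    {l : Filter ι} {α : ℝ} (hα : 0 < α) {A : ι → X →L[ℝ] Y} {A₀ : X →L[ℝ] Y}
    {r : ι → Y} {r₀ : Y} {u : ι → X} {u₀ : X}
    (hA : Tendsto A l (nhds A₀)) (hr : Tendsto r l (nhds r₀))
    (hu : ∀ j, adjoint (A j) (A j (u j)) + α • u j = adjoint (A j) (r j))
    (hu₀ : adjoint A₀ (A₀ u₀) + α • u₀ = adjoint A₀ r₀) :
    Tendsto u l (nhds u₀) := by
  have hAdj : Tendsto (fun j => adjoint (A j)) l (nhds (adjoint A₀)) :=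
    (adjoint.continuous.tendsto A₀).comp hA
  have hres : Tendsto (fun j => adjoint (A j) (r j) - (adjoint (A j) (A j u₀) + α • u₀)) l
      (nhds 0) := by
    have hev : Continuous fun p : (Y →L[ℝ] X) × Y => p.1 p.2 := by fun_prop
    have hev' : Continuous fun p : (X →L[ℝ] Y) × X => p.1 p.2 := by fun_prop
    have hAu := (hev'.tendsto (A₀, u₀)).comp (hA.prodMk_nhds tendsto_const_nhds)
    have := ((hev.tendsto (adjoint A₀, r₀)).comp (hAdj.prodMk_nhds hr)).sub
      (((hev.tendsto (adjoint A₀, A₀ u₀)).comp (hAdj.prodMk_nhds hAu)).add_const (α • u₀))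
    rwa [hu₀, sub_self] at this
  rw [tendsto_iff_norm_sub_tendsto_zero]
  have hbound : Tendsto
      (fun j => ‖adjoint (A j) (r j) - (adjoint (A j) (A j u₀) + α • u₀)‖ / α) l (nhds 0) := by
    simpa using hres.norm.div_const α
  refine squeeze_zero (fun _ => norm_nonneg _) (fun j => ?_) hbound
  rw [le_div_iff₀ hα, mul_comm]
  refine (mul_norm_le_norm_adjoint_apply_add_smul (A j) α (u j - u₀)).trans_eq ?_
  rw [← hu j, map_sub, map_sub, smul_sub]
  congr 1
  abel

/-- Stability: if `δ_j → 0` and `x_k^{δ_j}` are the l-LMK iterates for the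
noisy data `y^{δ_j}`, then for each fixed `k`, `x_k^{δ_j} → x_k` (the exact LMK iterate)
as `j → ∞`. -/
theorem stmt_16
    {X Y : Type*} [NormedAddCommGroup X] [InnerProductSpace ℝ X] [CompleteSpace X]
    [NormedAddCommGroup Y] [InnerProductSpace ℝ Y] [CompleteSpace Y]
    (N : ℕ) (hN : 1 ≤ N)
    (F : ℕ → X → Y) (F' : ℕ → X → (X →L[ℝ] Y))
    (hFcont : ∀ i < N, Continuous (F i)) (hF'cont : ∀ i < N, Continuous (F' i))
    (x₀ xstar : X) (ρ C η : ℝ) (hρ : 0 < ρ) (hC : 0 < C) (hη0 : 0 ≤ η) (hη1 : η < 1)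
    (hA1 : ∀ i < N, ∀ x ∈ closedBall x₀ ρ, ‖F' i x‖ ≤ C)
    (hA2 : ∀ i < N, ∀ x ∈ closedBall x₀ ρ, ∀ x' ∈ closedBall x₀ ρ,
        ‖F i x' - F i x - F' i x (x' - x)‖ ≤ η * ‖F i x' - F i x‖)
    (y : ℕ → Y) (hA3 : xstar ∈ closedBall x₀ (ρ / 2)) (hsol : ∀ i < N, F i xstar = y i)
    (q α τ : ℝ) (hq0 : 0 < q) (hq1 : q < 1)
    (hα : C ^ 2 * q / (1 - q) < α)
    (hτ : (1 + η) / (1 - η) < τ) (hqτ : η + (1 + η) / τ < q)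
    (x h : ℕ → X)
    (hx0 : x 0 = x₀)
    (hh : ∀ k, ContinuousLinearMap.adjoint (F' (k % N) (x k)) (F' (k % N) (x k) (h k))
        + α • h k
        = ContinuousLinearMap.adjoint (F' (k % N) (x k)) (y (k % N) - F (k % N) (x k)))
    (hrec : ∀ k, x (k + 1) = x k + h k)
    -- the noise levels δ_j (with components δs j i > 0), converging to zero
    (δs : ℕ → ℕ → ℝ) (hδs_pos : ∀ j, ∀ i < N, 0 < δs j i)
    (hδs_lim : ∀ i < N, Tendsto (fun j => δs j i) atTop (nhds 0))
    -- the corresponding noisy data y^{δ_j}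
    (ys : ℕ → ℕ → Y) (hys : ∀ j, ∀ i < N, ‖ys j i - y i‖ ≤ δs j i)
    -- the l-LMK iterates x_k^{δ_j} computed with data y^{δ_j} and noise levels δ_j
    (xs hs : ℕ → ℕ → X) (ωs : ℕ → ℕ → ℝ)
    (hxs0 : ∀ j, xs j 0 = x₀)
    (hωs : ∀ j k, ωs j k =
        if τ * δs j (k % N) ≤ ‖F (k % N) (xs j k) - ys j (k % N)‖ then 1 else 0)
    (hhs : ∀ j k,
        ContinuousLinearMap.adjoint (F' (k % N) (xs j k)) (F' (k % N) (xs j k) (hs j k))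
          + α • hs j k
        = ContinuousLinearMap.adjoint (F' (k % N) (xs j k))
            (ys j (k % N) - F (k % N) (xs j k)))
    (hrecs : ∀ j k, xs j (k + 1) = xs j k + ωs j k • hs j k)
    :
    ∀ k : ℕ, Tendsto (fun j => xs j k) atTop (nhds (x k)) := by
  have hα0 : 0 < α := lt_of_le_of_lt
    (div_nonneg (mul_nonneg (sq_nonneg C) hq0.le) (sub_nonneg.mpr hq1.le)) hα
  intro k
  induction k with
  | zero => simp [hxs0, hx0]
  | succ k ih =>
    have hi : k % N < N := Nat.mod_lt _ hN
    have hA : Tendsto (fun j => F' (k % N) (xs j k)) atTop (nhds (F' (k % N) (x k))) :=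
      ((hF'cont _ hi).tendsto _).comp ih
    have hF : Tendsto (fun j => F (k % N) (xs j k)) atTop (nhds (F (k % N) (x k))) :=
      ((hFcont _ hi).tendsto _).comp ih
    have hy : Tendsto (fun j => ys j (k % N)) atTop (nhds (y (k % N))) :=
      tendsto_iff_norm_sub_tendsto_zero.mpr
        (squeeze_zero (fun _ => norm_nonneg _) (fun j => hys j _ hi) (hδs_lim _ hi))
    have hstep : Tendsto (fun j => hs j k) atTop (nhds (h k)) :=
      tendsto_of_adjoint_apply_add_smul_eq hα0 hA (hy.sub hF) (fun j => hhs j k) (hh k)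
    have hskip : Tendsto (fun j => (1 - ωs j k) • hs j k) atTop (nhds 0) := by
      have hbound : Tendsto
          (fun j => ‖F' (k % N) (xs j k)‖ * |τ * δs j (k % N)| / α) atTop (nhds 0) := by
        simpa using (hA.norm.mul ((hδs_lim _ hi).const_mul τ).abs).div_const α
      refine squeeze_zero_norm (fun j => ?_) hbound
      rw [hωs j k]
      split_ifs with hω
      · simp only [sub_self, zero_smul, norm_zero]
        positivity
      · rw [sub_zero, one_smul, le_div_iff₀ hα0, mul_comm]
        refine (mul_norm_le_norm_adjoint_apply_add_smul (F' (k % N) (xs j k)) α _).trans ?_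
        rw [hhs j k]
        refine (ContinuousLinearMap.le_opNorm _ _).trans ?_
        rw [LinearIsometryEquiv.norm_map, norm_sub_rev]
        gcongr
        exact (not_le.mp hω).le.trans (le_abs_self _)
    have hsum := (ih.add hstep).sub hskip
    rw [sub_zero, ← hrec k] at hsum
    refine hsum.congr fun j => ?_
    rw [hrecs j k, sub_smul, one_smul]
    abel
end

section
/- (Range invariance implies the tangential cone condition) Let F : X → Y be continuously Fréchet differentiable on the closed ball B_ρ(x₀), and suppose there exist bounded linear operators R(x̄, x) : Y → Y, for x, x̄ ∈ B_ρ(x₀), such that F'(x̄) = R(x̄, x) F'(x) and ‖R(x̄, x) − I‖ ≤ c_R for some constant 0 < c_R < 1. Then for all x, x̄ ∈ B_ρ(x₀) the tangential cone condition ‖F(x̄) − F(x) − F'(x)(x̄ − x)‖ ≤ η ‖F(x̄) − F(x)‖ holds with η = c_R (1 − c_R)^{-1}. -/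
open Metric

/-- Range invariance implies the tangential cone condition: if `F` is
continuously Fréchet differentiable on the closed ball `B_ρ(x₀)` and there are bounded
linear operators `R(x̄, x)` with `F'(x̄) = R(x̄, x) ∘ F'(x)` and `‖R(x̄, x) - I‖ ≤ c_R < 1`
on the ball, then the tangential cone condition holds there with `η = c_R (1 - c_R)⁻¹`. -/
theorem stmt_18
    {X Y : Type*} [NormedAddCommGroup X] [InnerProductSpace ℝ X] [CompleteSpace X]
    [NormedAddCommGroup Y] [InnerProductSpace ℝ Y] [CompleteSpace Y]
    (x₀ : X) (ρ : ℝ) (hρ : 0 < ρ)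
    (F : X → Y) (F' : X → (X →L[ℝ] Y))
    (hdiff : ∀ x ∈ closedBall x₀ ρ, HasFDerivWithinAt F (F' x) (closedBall x₀ ρ) x)
    (hF'cont : ContinuousOn F' (closedBall x₀ ρ))
    (cR : ℝ) (hcR0 : 0 < cR) (hcR1 : cR < 1)
    (R : X → X → (Y →L[ℝ] Y))
    (hR : ∀ x ∈ closedBall x₀ ρ, ∀ xb ∈ closedBall x₀ ρ, F' xb = R xb x ∘L F' x)
    (hRI : ∀ x ∈ closedBall x₀ ρ, ∀ xb ∈ closedBall x₀ ρ,
        ‖R xb x - (1 : Y →L[ℝ] Y)‖ ≤ cR) :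
    ∀ x ∈ closedBall x₀ ρ, ∀ xb ∈ closedBall x₀ ρ,
      ‖F xb - F x - F' x (xb - x)‖ ≤ cR * (1 - cR)⁻¹ * ‖F xb - F x‖ := by
  intro x hx xb hxb
  set v := F' x (xb - x)
  have hseg : Set.MapsTo (AffineMap.lineMap x xb : ℝ → X) (Set.Icc 0 1) (closedBall x₀ ρ) :=
    fun t ht => (convex_closedBall x₀ ρ).lineMap_mem hx hxb ht
  have hderiv : ∀ t ∈ Set.Icc (0 : ℝ) 1,
      HasDerivWithinAt (fun t : ℝ => F (AffineMap.lineMap x xb t) - t • v)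
        (F' (AffineMap.lineMap x xb t) (xb - x) - v) (Set.Icc 0 1) t := by
    intro t ht
    have hF := (hdiff _ (hseg ht)).comp_hasDerivWithinAt t
      AffineMap.hasDerivWithinAt_lineMap hseg
    have hlin := ((hasDerivAt_id t).smul_const v).hasDerivWithinAt (s := Set.Icc 0 1)
    rw [one_smul] at hlin
    exact hF.sub hlin
  have hbound : ∀ t ∈ Set.Ico (0 : ℝ) 1,
      ‖F' (AffineMap.lineMap x xb t) (xb - x) - v‖ ≤ cR * ‖v‖ := by
    intro t ht
    have hmem := hseg (Set.Ico_subset_Icc_self ht)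
    rw [hR x hx _ hmem]
    exact (R (AffineMap.lineMap x xb t) x - 1).le_of_opNorm_le (hRI x hx _ hmem) v
  have hmain : ‖F xb - F x - v‖ ≤ cR * ‖v‖ := by
    have h := norm_image_sub_le_of_norm_deriv_le_segment_01' hderiv hbound
    simpa [sub_right_comm] using h
  have htri : ‖v‖ ≤ ‖F xb - F x‖ + ‖F xb - F x - v‖ := by
    simpa using norm_sub_le (F xb - F x) (F xb - F x - v)
  have hpos : 0 < 1 - cR := sub_pos.2 hcR1
  rw [mul_right_comm, ← div_eq_mul_inv, le_div_iff₀ hpos]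
  linarith [mul_le_mul_of_nonneg_left htri hcR0.le]
end
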